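/- arXiv:2411.11462 — 3 statements merged into one kernel-verified Lean document; each statement's English description precedes it below -/
import Mathlib

section
/- Let 0 < w ≤ π/2 and let T_w = [v₁,v₂,v₃] ⊂ S² be a regular spherical triangle of width w. For ε > 0 let v₃^ε be the point on the geodesic line through v₂ and v₃ with d(v₃, v₃^ε) = ε and v₃ ∈ [v₂, v₃^ε], such that v₁, v₂, v₃^ε lie in an open hemisphere, and set K_ε = [v₁, v₂, v₃^ε]. Then: (1) there exists ε_w > 0 depending only on w such that w(K_ε) = w for all 0 < ε < ε_w; (2) δ(K_ε, T) ≥ ε/2 for every regular spherical triangle T of width w; (3) there exist constants c_w, ε_w > 0 depending only on w such that area(K_ε) ≤ area(T_w) + c_w·ε for all 0 < ε < ε_w. -/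
open scoped RealInnerProductSpace
open Real MeasureTheory

noncomputable section

namespace SphericalPal

/-- Ambient Euclidean space of the sphere `Sⁿ`. -/
abbrev E (n : ℕ) := EuclideanSpace ℝ (Fin (n + 1))

/-- The unit sphere `Sⁿ ⊂ ℝⁿ⁺¹`. -/
def unitSphere (n : ℕ) : Set (E n) := Metric.sphere 0 1

variable {n : ℕ}

/-- Geodesic (angular) distance on the unit sphere. -/
def gdist (x y : E n) : ℝ := Real.arccos ⟪x, y⟫

/-- The geodesic segment joining `x` and `y` on the sphere. -/
def seg (x y : E n) : Set (E n) :=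
  {z ∈ unitSphere n | gdist x z + gdist z y = gdist x y}

/-- A subset of the sphere is spherically convex if it lies on the sphere, is contained
in an open hemisphere and contains the geodesic segment joining any two of its points. -/
def SConvex (X : Set (E n)) : Prop :=
  X ⊆ unitSphere n ∧
  (∃ u ∈ unitSphere n, ∀ x ∈ X, 0 < ⟪u, x⟫) ∧
  ∀ x ∈ X, ∀ y ∈ X, seg x y ⊆ X

/-- Spherical convex hull. -/
def sconv (X : Set (E n)) : Set (E n) := ⋂₀ {C | SConvex C ∧ X ⊆ C}

/-- Relative (spherical) interior of a subset of the sphere. -/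
def sInterior (X : Set (E n)) : Set (E n) :=
  {x ∈ X | ∃ ε > 0, ∀ y ∈ unitSphere n, gdist x y < ε → y ∈ X}

/-- A spherical convex body: compact, spherically convex, with nonempty relative interior. -/
def IsConvexBody (K : Set (E n)) : Prop :=
  SConvex K ∧ IsCompact K ∧ (sInterior K).Nonempty

/-- The lune determined by `u` and `v` (intersection of the closed hemispheres
opposite to `u` and to `v`). -/
def lune (u v : E n) : Set (E n) := {x ∈ unitSphere n | ⟪x, u⟫ ≤ 0 ∧ ⟪x, v⟫ ≤ 0}

/-- The bounding hemisphere of `lune u v` contained in the great sphere orthogonal to `u`. -/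
def luneFace (u v : E n) : Set (E n) := {x ∈ unitSphere n | ⟪x, u⟫ = 0 ∧ ⟪x, v⟫ ≤ 0}

/-- The center (midpoint) of the bounding hemisphere `luneFace u v`. -/
def luneFaceCenter (u v : E n) : E n :=
  ‖(⟪u, v⟫ • u - v : E n)‖⁻¹ • (⟪u, v⟫ • u - v)

/-- The breadth of the lune `lune u v`: the geodesic distance of the centers of the
two bounding hemispheres. -/
def breadth (u v : E n) : ℝ := gdist (luneFaceCenter u v) (luneFaceCenter v u)

/-- `lune u v` is a supporting lune of `K`. -/
def IsSupportingLune (K : Set (E n)) (u v : E n) : Prop :=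
  u ∈ unitSphere n ∧ v ∈ unitSphere n ∧ u ≠ v ∧ u ≠ -v ∧
  K ⊆ lune u v ∧ (K ∩ luneFace u v).Nonempty ∧ (K ∩ luneFace v u).Nonempty

/-- The (minimal) width of a spherical convex body. -/
def width (K : Set (E n)) : ℝ :=
  sInf {b | ∃ u v : E n, IsSupportingLune K u v ∧ b = breadth u v}

/-- The width of `K` with respect to the supporting great hypersphere orthogonal to `u`:
the minimal breadth among supporting lunes of `K` having one bounding hemisphere
contained in that great hypersphere. -/
def widthAt (K : Set (E n)) (u : E n) : ℝ :=
  sInf {b | ∃ v : E n, IsSupportingLune K u v ∧ b = breadth u v}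

/-- The great hypersphere orthogonal to `u` supports `K`. -/
def IsSupportingSphere (K : Set (E n)) (u : E n) : Prop :=
  u ∈ unitSphere n ∧ (∀ x ∈ K, ⟪x, u⟫ ≤ 0) ∧ ∃ x ∈ K, ⟪x, u⟫ = 0

/-- `K` is of constant width `w`. -/
def HasConstantWidth (K : Set (E n)) (w : ℝ) : Prop :=
  ∀ u : E n, IsSupportingSphere K u → widthAt K u = w

/-- `K` is a reduced convex body. -/
def IsReduced (K : Set (E n)) : Prop :=
  IsConvexBody K ∧ ∀ L : Set (E n), IsConvexBody L → L ⊆ K → L ≠ K → width L < width K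

/-- The spherical polar set. -/
def polar (A : Set (E n)) : Set (E n) := {u ∈ unitSphere n | ∀ a ∈ A, ⟪a, u⟫ ≤ 0}

/-- Closed geodesic ball on the sphere. -/
def gball (p : E n) (r : ℝ) : Set (E n) := {x ∈ unitSphere n | gdist p x ≤ r}

/-- The inradius of `K`: the largest `r` such that some geodesic ball of radius `r`
is contained in `K`. -/
def inradius (K : Set (E n)) : ℝ :=
  sSup {r | 0 ≤ r ∧ ∃ p ∈ unitSphere n, gball p r ⊆ K}

/-- Geodesic distance from a point to a set. -/
def sdist (x : E n) (A : Set (E n)) : ℝ := sInf (gdist x '' A)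

/-- Hausdorff distance with respect to the geodesic metric. -/
def hausdorffG (A B : Set (E n)) : ℝ :=
  max (sSup ((fun x => sdist x B) '' A)) (sSup ((fun y => sdist y A) '' B))

/-- Two subsets of the sphere are congruent, i.e., isometric by an orthogonal
transformation of the ambient Euclidean space. -/
def Congruent (A B : Set (E n)) : Prop :=
  ∃ f : E n ≃ₗᵢ[ℝ] E n, f '' A = B

/-- Spherical surface measure on `S²` (2-dimensional Hausdorff measure). -/
def area (X : Set (E 2)) : ℝ := (μH[2] X).toReal

/-- The spherical angle `∠(x, p, y)` at `p` between the geodesic segments `[p,x]`, `[p,y]`. -/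
def sangle (x p y : E 2) : ℝ :=
  InnerProductGeometry.angle (x - ⟪p, x⟫ • p) (y - ⟪p, y⟫ • p)

/-- `T` is a regular spherical triangle: the spherical convex hull of three points
with equal pairwise geodesic distances, not lying on a common great circle. -/
def IsRegularTriangle (T : Set (E 2)) : Prop :=
  ∃ v₁ v₂ v₃ : E 2, v₁ ∈ unitSphere 2 ∧ v₂ ∈ unitSphere 2 ∧ v₃ ∈ unitSphere 2 ∧
    LinearIndependent ℝ ![v₁, v₂, v₃] ∧
    gdist v₁ v₂ = gdist v₂ v₃ ∧ gdist v₂ v₃ = gdist v₁ v₃ ∧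
    T = sconv {v₁, v₂, v₃}

/-- Three points on the sphere with equal pairwise geodesic distance `a`
(the vertices of a regular spherical triangle of side length `a`). -/
def IsRegularCenters (x₁ x₂ x₃ : E 2) (a : ℝ) : Prop :=
  x₁ ∈ unitSphere 2 ∧ x₂ ∈ unitSphere 2 ∧ x₃ ∈ unitSphere 2 ∧
  gdist x₁ x₂ = a ∧ gdist x₂ x₃ = a ∧ gdist x₁ x₃ = a

/-- `U` is a spherical Reuleaux triangle: intersection of three geodesic balls of radius `r`
whose centers have pairwise geodesic distance `r`. -/
def IsReuleaux (U : Set (E 2)) (r : ℝ) : Prop :=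
  ∃ x₁ x₂ x₃ : E 2, IsRegularCenters x₁ x₂ x₃ r ∧
    U = gball x₁ r ∩ gball x₂ r ∩ gball x₃ r

/-- The body `U°_{π-w}` for `w > π/2`: the spherical convex hull of three geodesic balls
of radius `w - π/2` (whose centers are meant to form a regular triangle of side `π - w`). -/
def polarReuleaux (x₁ x₂ x₃ : E 2) (w : ℝ) : Set (E 2) :=
  sconv (gball x₁ (w - π / 2) ∪ gball x₂ (w - π / 2) ∪ gball x₃ (w - π / 2))

end SphericalPal

open SphericalPal

/-- `y` is the point `v₃^ε` of the construction: it lies on the unit sphere, on the geodesic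
line (great circle) through `v₂` and `v₃`, at distance `ε` from `v₃`, with
`v₃ ∈ [v₂, y]`, and `v₁, v₂, y` lie in a common open hemisphere. -/
def ExtPoint (v₁ v₂ v₃ : E 2) (ε : ℝ) (y : E 2) : Prop :=
  y ∈ unitSphere 2 ∧ y ∈ (Submodule.span ℝ ({v₂, v₃} : Set (E 2)) : Submodule ℝ (E 2)) ∧
  gdist v₃ y = ε ∧ v₃ ∈ seg v₂ y ∧
  ∃ u ∈ unitSphere 2, 0 < ⟪u, v₁⟫ ∧ 0 < ⟪u, v₂⟫ ∧ 0 < ⟪u, y⟫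

namespace SphericalPal

lemma mem_unitSphere_iff {x : E 2} : x ∈ unitSphere 2 ↔ ‖x‖ = 1 := by
  simp [unitSphere]

lemma gdist_eq_angle {x y : E 2} (hx : ‖x‖ = 1) (hy : ‖y‖ = 1) :
    gdist x y = InnerProductGeometry.angle x y := by
  simp [gdist, InnerProductGeometry.angle, hx, hy]

lemma inner_self_one {x : E 2} (hx : ‖x‖ = 1) : ⟪x, x⟫ = 1 := by
  rw [real_inner_self_eq_norm_sq, hx]; norm_num

lemma inner_mem_Icc {x y : E 2} (hx : ‖x‖ = 1) (hy : ‖y‖ = 1) :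
    -1 ≤ ⟪x, y⟫ ∧ ⟪x, y⟫ ≤ 1 := by
  have := abs_real_inner_le_norm x y
  rw [hx, hy, one_mul] at this
  exact abs_le.mp this

lemma gdist_triangle {x y z : E 2} (hx : ‖x‖ = 1) (hy : ‖y‖ = 1) (hz : ‖z‖ = 1) :
    gdist x z ≤ gdist x y + gdist y z := by
  rw [gdist_eq_angle hx hz, gdist_eq_angle hx hy, gdist_eq_angle hy hz]
  exact InnerProductGeometry.angle_le_angle_add_angle x y z

lemma gdist_comm (x y : E 2) : gdist x y = gdist y x := by
  simp [gdist, real_inner_comm]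

/-- points of a geodesic segment are nonnegative combinations of the end points -/
lemma seg_comb {x y z u : E 2} (hx : ‖x‖ = 1) (hy : ‖y‖ = 1)
    (hux : 0 < ⟪u, x⟫) (huy : 0 < ⟪u, y⟫) (hz : z ∈ seg x y) :
    ∃ a b : ℝ, 0 ≤ a ∧ 0 ≤ b ∧ z = a • x + b • y := by
  obtain ⟨hz1, hz2⟩ := hz
  rw [mem_unitSphere_iff] at hz1
  rw [gdist_eq_angle hx hz1, gdist_eq_angle hz1 hy, gdist_eq_angle hx hy] at hz2
  have hz0 : z ≠ 0 := by rintro rfl; simp at hz1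
  rcases (InnerProductGeometry.angle_eq_angle_add_angle_iff hz0).1 hz2.symm with h | h
  · exfalso
    obtain ⟨-, r, hr, hr'⟩ := InnerProductGeometry.angle_eq_pi_iff.1 h
    rw [hr', real_inner_smul_right] at huy
    nlinarith
  · rw [Submodule.mem_span_pair] at h
    obtain ⟨a, b, h⟩ := h
    exact ⟨a, b, a.2, b.2, h.symm⟩

lemma comb_seg {x y z : E 2} (hx : ‖x‖ = 1) (hy : ‖y‖ = 1) (hz : ‖z‖ = 1)
    {a b : ℝ} (ha : 0 ≤ a) (hb : 0 ≤ b) (h : z = a • x + b • y) : z ∈ seg x y := by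
  refine ⟨mem_unitSphere_iff.2 hz, ?_⟩
  have hz0 : z ≠ 0 := by rintro rfl; simp at hz
  rw [gdist_eq_angle hx hz, gdist_eq_angle hz hy, gdist_eq_angle hx hy]
  refine (InnerProductGeometry.angle_eq_angle_add_add_angle_add_of_mem_span hz0 ?_).symm
  rw [Submodule.mem_span_pair]
  exact ⟨⟨a, ha⟩, ⟨b, hb⟩, h.symm⟩

/-- the closed convex cone spanned by three vectors -/
def cone3 (p q r : E 2) : Set (E 2) :=
  {x | ∃ a b c : ℝ, 0 ≤ a ∧ 0 ≤ b ∧ 0 ≤ c ∧ x = a • p + b • q + c • r}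

lemma cone3_comb {p q r x y : E 2} (hx : x ∈ cone3 p q r) (hy : y ∈ cone3 p q r)
    {s t : ℝ} (hs : 0 ≤ s) (ht : 0 ≤ t) : s • x + t • y ∈ cone3 p q r := by
  obtain ⟨a, b, c, ha, hb, hc, rfl⟩ := hx
  obtain ⟨a', b', c', ha', hb', hc', rfl⟩ := hy
  refine ⟨s * a + t * a', s * b + t * b', s * c + t * c', by positivity, by positivity,
    by positivity, by module⟩

lemma cone3_pos {p q r u x : E 2} (hp : 0 < ⟪u, p⟫) (hq : 0 < ⟪u, q⟫) (hr : 0 < ⟪u, r⟫)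
    (hx : x ∈ cone3 p q r) (hx0 : ‖x‖ = 1) : 0 < ⟪u, x⟫ := by
  obtain ⟨a, b, c, ha, hb, hc, rfl⟩ := hx
  simp only [inner_add_right, real_inner_smul_right]
  rcases ha.eq_or_lt with rfl | ha
  · rcases hb.eq_or_lt with rfl | hb
    · rcases hc.eq_or_lt with rfl | hc
      · simp at hx0
      · positivity
    · positivity
  · positivity

lemma subset_sconv (X : Set (E 2)) : X ⊆ sconv X := fun _ hx _ hC => hC.2 hx

lemma sconv_subset_cone {p q r u : E 2} (hp1 : ‖p‖ = 1) (hq1 : ‖q‖ = 1) (hr1 : ‖r‖ = 1)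
    (hp : 0 < ⟪u, p⟫) (hq : 0 < ⟪u, q⟫) (hr : 0 < ⟪u, r⟫) :
    ∀ x ∈ sconv {p, q, r}, ‖x‖ = 1 ∧ x ∈ cone3 p q r := by
  intro x hx
  have hu0 : u ≠ 0 := by rintro rfl; simp at hp
  have key : SConvex ({x : E 2 | ‖x‖ = 1 ∧ x ∈ cone3 p q r}) := by
    refine ⟨fun x hx => mem_unitSphere_iff.2 hx.1, ⟨‖u‖⁻¹ • u, ?_, ?_⟩, ?_⟩
    · rw [mem_unitSphere_iff]; exact norm_smul_inv_norm hu0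
    · intro x hx
      rw [real_inner_smul_left]
      have := cone3_pos hp hq hr hx.2 hx.1
      positivity
    · intro x hx y hy z hz
      obtain ⟨a, b, ha, hb, h⟩ := seg_comb hx.1 hy.1 (cone3_pos hp hq hr hx.2 hx.1)
        (cone3_pos hp hq hr hy.2 hy.1) hz
      exact ⟨mem_unitSphere_iff.1 hz.1, h ▸ cone3_comb hx.2 hy.2 ha hb⟩
  refine hx _ ⟨key, ?_⟩
  rintro x (rfl | rfl | rfl)
  · exact ⟨hp1, 1, 0, 0, by norm_num, by norm_num, by norm_num, by simp⟩
  · exact ⟨hq1, 0, 1, 0, by norm_num, by norm_num, by norm_num, by simp⟩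
  · exact ⟨hr1, 0, 0, 1, by norm_num, by norm_num, by norm_num, by simp⟩

lemma cone_subset_sconv {p q r x : E 2} (hp1 : ‖p‖ = 1) (hq1 : ‖q‖ = 1) (hr1 : ‖r‖ = 1)
    (hx1 : ‖x‖ = 1) (hx : x ∈ cone3 p q r) : x ∈ sconv {p, q, r} := by
  obtain ⟨a, b, c, ha, hb, hc, rfl⟩ := hx
  rintro C ⟨⟨hC1, -, hC3⟩, hX⟩
  have hp : p ∈ C := hX (by simp)
  have hq : q ∈ C := hX (by simp)
  have hr : r ∈ C := hX (by simp)
  by_cases h0 : a • p + b • q = 0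
  · exact hC3 r hr r hr (comb_seg hr1 hr1 hx1 le_rfl hc (by rw [h0]; simp))
  · set z := ‖a • p + b • q‖⁻¹ • (a • p + b • q) with hz
    have hz1 : ‖z‖ = 1 := norm_smul_inv_norm h0
    have hzC : z ∈ C := by
      refine hC3 p hp q hq (comb_seg hp1 hq1 hz1 (a := ‖a • p + b • q‖⁻¹ * a)
        (b := ‖a • p + b • q‖⁻¹ * b) (by positivity) (by positivity) ?_)
      rw [hz]; module
    refine hC3 z hzC r hr (comb_seg hz1 hr1 hx1 (norm_nonneg (a • p + b • q)) hc ?_)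
    rw [hz, smul_smul, mul_inv_cancel₀ (norm_ne_zero_iff.2 h0), one_smul]

lemma breadth_eq {u v : E 2} (hu : ‖u‖ = 1) (hv : ‖v‖ = 1) (h1 : u ≠ v) (h2 : u ≠ -v) :
    breadth u v = Real.arccos (-⟪u, v⟫) := by
  have hs1 : ⟪u, v⟫ ≠ 1 := fun h => h1 ((inner_eq_one_iff_of_norm_eq_one hu hv).1 h)
  have hs2 : ⟪u, v⟫ ≠ -1 := fun h => h2
    ((inner_eq_one_iff_of_norm_eq_one (𝕜 := ℝ) hu (by rwa [norm_neg])).1 (by rw [inner_neg_right, h, neg_neg]))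
  obtain ⟨h3, h4⟩ := inner_mem_Icc hu hv
  have hpos : 0 < 1 - ⟪u, v⟫ ^ 2 := by
    have : -1 < ⟪u, v⟫ := lt_of_le_of_ne h3 (Ne.symm hs2)
    have : ⟪u, v⟫ < 1 := lt_of_le_of_ne h4 hs1
    nlinarith
  have huu := inner_self_one hu
  have hvv := inner_self_one hv
  have hvu : ⟪v, u⟫ = ⟪u, v⟫ := real_inner_comm _ _
  have hn1 : ‖⟪u, v⟫ • u - v‖ ^ 2 = 1 - ⟪u, v⟫ ^ 2 := by
    rw [← real_inner_self_eq_norm_sq]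
    simp only [inner_sub_left, inner_sub_right, real_inner_smul_left, real_inner_smul_right, huu, hvv, hvu]
    ring
  have hn2 : ‖⟪u, v⟫ • v - u‖ ^ 2 = 1 - ⟪u, v⟫ ^ 2 := by
    rw [← real_inner_self_eq_norm_sq]
    simp only [inner_sub_left, inner_sub_right, real_inner_smul_left, real_inner_smul_right, huu, hvv, hvu]
    ring
  have hn : ‖⟪u, v⟫ • u - v‖ = ‖⟪u, v⟫ • v - u‖ := by
    rw [← sq_eq_sq₀ (norm_nonneg _) (norm_nonneg _), hn1, hn2]
  unfold breadth gdist luneFaceCenter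
  congr 1
  rw [hvu, real_inner_smul_left, real_inner_smul_right, hn, ← mul_assoc, ← mul_inv, ← sq, hn2,
    inv_mul_eq_iff_eq_mul₀ hpos.ne']
  simp only [inner_sub_left, inner_sub_right, real_inner_smul_left, real_inner_smul_right, huu, hvv, hvu]
  ring

end SphericalPal
namespace SphericalPal

/-- three unit vectors with pairwise inner products `c` -/
structure Gram (v₁ v₂ v₃ : E 2) (c : ℝ) : Prop where
  n1 : ‖v₁‖ = 1
  n2 : ‖v₂‖ = 1
  n3 : ‖v₃‖ = 1
  i12 : ⟪v₁, v₂⟫ = c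
  i23 : ⟪v₂, v₃⟫ = c
  i13 : ⟪v₁, v₃⟫ = c

variable {v₁ v₂ v₃ : E 2} {c : ℝ}

lemma Gram.swap12 (h : Gram v₁ v₂ v₃ c) : Gram v₂ v₁ v₃ c :=
  ⟨h.n2, h.n1, h.n3, by rw [real_inner_comm]; exact h.i12, h.i13, h.i23⟩

lemma Gram.swap23 (h : Gram v₁ v₂ v₃ c) : Gram v₁ v₃ v₂ c :=
  ⟨h.n1, h.n3, h.n2, h.i13, by rw [real_inner_comm]; exact h.i23, h.i12⟩

lemma Gram.inner_comb (h : Gram v₁ v₂ v₃ c) (a₁ a₂ a₃ b₁ b₂ b₃ : ℝ) :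
    ⟪a₁ • v₁ + a₂ • v₂ + a₃ • v₃, b₁ • v₁ + b₂ • v₂ + b₃ • v₃⟫ =
      a₁ * b₁ + a₂ * b₂ + a₃ * b₃ +
      c * (a₁ * b₂ + a₂ * b₁ + a₁ * b₃ + a₃ * b₁ + a₂ * b₃ + a₃ * b₂) := by
  have e1 := inner_self_one h.n1
  have e2 := inner_self_one h.n2
  have e3 := inner_self_one h.n3
  have e21 : ⟪v₂, v₁⟫ = c := by rw [real_inner_comm]; exact h.i12
  have e31 : ⟪v₃, v₁⟫ = c := by rw [real_inner_comm]; exact h.i13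
  have e32 : ⟪v₃, v₂⟫ = c := by rw [real_inner_comm]; exact h.i23
  simp only [inner_add_left, inner_add_right, real_inner_smul_left, real_inner_smul_right,
    e1, e2, e3, e21, e31, e32, h.i12, h.i23, h.i13]
  ring

lemma Gram.inner_comb_one (h : Gram v₁ v₂ v₃ c) (a₁ a₂ a₃ : ℝ) :
    ⟪a₁ • v₁ + a₂ • v₂ + a₃ • v₃, v₁⟫ = a₁ + c * (a₂ + a₃) := by
  have := h.inner_comb a₁ a₂ a₃ 1 0 0
  simp only [one_smul, zero_smul, add_zero] at this
  rw [this]; ring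

lemma Gram.inner_comb_two (h : Gram v₁ v₂ v₃ c) (a₁ a₂ a₃ : ℝ) :
    ⟪a₁ • v₁ + a₂ • v₂ + a₃ • v₃, v₂⟫ = a₂ + c * (a₁ + a₃) := by
  have := h.inner_comb a₁ a₂ a₃ 0 1 0
  simp only [one_smul, zero_smul, add_zero, zero_add] at this
  rw [this]; ring

lemma Gram.inner_comb_three (h : Gram v₁ v₂ v₃ c) (a₁ a₂ a₃ : ℝ) :
    ⟪a₁ • v₁ + a₂ • v₂ + a₃ • v₃, v₃⟫ = a₃ + c * (a₁ + a₂) := by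
  have := h.inner_comb a₁ a₂ a₃ 0 0 1
  simp only [one_smul, zero_smul, zero_add] at this
  rw [this]; ring

lemma caseC (c x₁ x₂ x₃ : ℝ) (hc0 : 0 ≤ c) (hc1 : c < 1) (_h12 : x₂ ≤ x₁) (h23 : x₃ ≤ x₂)
    (ha3 : 0 ≤ x₃ + c * (x₁ + x₂)) (hx3 : x₃ < 0)
    (hn : x₁ ^ 2 + x₂ ^ 2 + x₃ ^ 2 + 2 * c * (x₁ * x₂ + x₁ * x₃ + x₂ * x₃) = 1)
    (hv : (x₁ + c * (x₂ + x₃)) ^ 2 * (1 + c) < (1 - c) * (1 + 2 * c)) :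
    0 ≤ (1 + c) * x₂ + c * x₃ ∧ x₃ ^ 2 * ((1 - c) * (1 + 2 * c)) ≤ 2 * c ^ 2 := by
  constructor
  · by_contra hneg
    push Not at hneg
    obtain ⟨a₁, ha₁⟩ : ∃ a, a = x₁ + c * (x₂ + x₃) := ⟨_, rfl⟩
    obtain ⟨a₂, ha₂⟩ : ∃ a, a = x₂ + c * (x₁ + x₃) := ⟨_, rfl⟩
    obtain ⟨a₃, ha₃⟩ : ∃ a, a = x₃ + c * (x₁ + x₂) := ⟨_, rfl⟩
    rw [← ha₁] at hv
    rw [← ha₃] at ha3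
    have h32 : a₃ ≤ a₂ := by nlinarith
    have h2 : a₂ ≤ c * a₁ := by
      have : a₂ - c * a₁ = (1 - c) * ((1 + c) * x₂ + c * x₃) := by rw [ha₁, ha₂]; ring
      nlinarith
    have hid : (1 + c) * (a₁ ^ 2 + a₂ ^ 2 + a₃ ^ 2) - 2 * c * (a₁ * a₂ + a₁ * a₃ + a₂ * a₃)
        = (1 - c) * (1 + 2 * c) := by
      rw [ha₁, ha₂, ha₃]
      linear_combination ((1 - c) * (1 + 2 * c)) * hn
    have e1 : a₂ * (a₂ + a₃) ≤ c * a₁ * (a₂ + a₃) :=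
      mul_le_mul_of_nonneg_right h2 (by linarith)
    have e2 : 0 ≤ c * (a₂ * a₃) := by have : 0 ≤ a₂ := by linarith
                                      positivity
    have e3 : a₃ * a₃ ≤ a₂ * a₃ := mul_le_mul_of_nonneg_right h32 ha3
    have e4 : (1 + c) * (a₂ ^ 2 + a₃ ^ 2) ≤ 2 * (a₂ ^ 2 + a₃ ^ 2) :=
      mul_le_mul_of_nonneg_right (by linarith) (by positivity)
    nlinarith
  · obtain ⟨s, hs⟩ : ∃ s, s = (1 + c) * (x₁ + x₂) + 2 * c * x₃ := ⟨_, rfl⟩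
    have hD : 0 < (1 - c) * (1 + 2 * c) := by
      have : 0 < 1 - c := by linarith
      positivity
    have h1 : -(x₃ * ((1 - c) * (1 + 2 * c))) ≤ c * s := by
      have : c * s + x₃ * ((1 - c) * (1 + 2 * c)) = (1 + c) * (x₃ + c * (x₁ + x₂)) := by
        rw [hs]; ring
      have : 0 ≤ (1 + c) * (x₃ + c * (x₁ + x₂)) := by positivity
      linarith
    have h2 : (x₃ * ((1 - c) * (1 + 2 * c))) ^ 2 ≤ (c * s) ^ 2 := by
      rw [← neg_sq]
      exact pow_le_pow_left₀ (by nlinarith) h1 2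
    have h3 : s ^ 2 ≤ 2 * (1 + c) - 2 * x₃ ^ 2 * ((1 - c) * (1 + 2 * c)) := by
      have e : 2 * (1 + c) - 2 * x₃ ^ 2 * ((1 - c) * (1 + 2 * c)) - s ^ 2
          = (1 + c) * (1 - c) * (x₁ - x₂) ^ 2 := by
        rw [hs]; linear_combination (-2 * (1 + c)) * hn
      have : 0 ≤ (1 + c) * (1 - c) * (x₁ - x₂) ^ 2 := by
        have : 0 < 1 - c := by linarith
        positivity
      linarith
    have h4 : c ^ 2 * s ^ 2 ≤ c ^ 2 * (2 * (1 + c) - 2 * x₃ ^ 2 * ((1 - c) * (1 + 2 * c))) :=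
      mul_le_mul_of_nonneg_left h3 (by positivity)
    have h5 : (x₃ ^ 2 * ((1 - c) * (1 + 2 * c)) - 2 * c ^ 2) * (1 + c) ≤ 0 := by
      have : (x₃ ^ 2 * ((1 - c) * (1 + 2 * c))) * ((1 - c) * (1 + 2 * c)) ≤ c ^ 2 * (2 * (1 + c) - 2 * x₃ ^ 2 * ((1 - c) * (1 + 2 * c))) := by
        nlinarith
      nlinarith
    nlinarith

/-- the cosine of the width -/
def mcos (c : ℝ) : ℝ := 2 * c / √(2 * (1 + c))

lemma mcos_nonneg (hc : 0 ≤ c) : 0 ≤ mcos c := by unfold mcos; positivity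

lemma mcos_sq (hc : 0 ≤ c) : mcos c ^ 2 = 2 * c ^ 2 / (1 + c) := by
  unfold mcos
  rw [div_pow, Real.sq_sqrt (by positivity)]
  field_simp

lemma sub_bound {q r x : E 2} {m : ℝ} (hm : 0 ≤ m) (hr : ‖r‖ = 1) (hx : 0 ≤ ⟪x, r⟫)
    (h : ⟪q - x, q - x⟫ ≤ m ^ 2) : -⟪q, r⟫ ≤ m := by
  have h1 : ‖q - x‖ ≤ m := by
    rw [real_inner_self_eq_norm_sq] at h
    exact (sq_le_sq₀ (norm_nonneg _) hm).1 h
  have h2 := abs_real_inner_le_norm (q - x) r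
  rw [hr, mul_one, inner_sub_left] at h2
  have := (abs_le.1 h2).1
  linarith

lemma sorted_bound (h : Gram v₁ v₂ v₃ c) (hc0 : 0 ≤ c) (hc1 : c < 1) {q r : E 2}
    (hq1 : ‖q‖ = 1) (hr1 : ‖r‖ = 1) (hq3 : 0 ≤ ⟪q, v₃⟫)
    (r1 : 0 ≤ ⟪r, v₁⟫) (r2 : 0 ≤ ⟪r, v₂⟫) (r3 : 0 ≤ ⟪r, v₃⟫) {x₁ x₂ x₃ : ℝ}
    (hq : q = x₁ • v₁ + x₂ • v₂ + x₃ • v₃) (h12 : x₂ ≤ x₁) (h23 : x₃ ≤ x₂) :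
    -⟪q, r⟫ ≤ mcos c := by
  have hm := mcos_nonneg hc0
  rw [real_inner_comm] at r1 r2 r3
  have hn := inner_self_one hq1
  rw [hq, h.inner_comb] at hn
  rw [hq, h.inner_comb_three] at hq3
  by_cases hx3 : 0 ≤ x₃
  · have : 0 ≤ ⟪q, r⟫ := by
      rw [hq]
      simp only [inner_add_left, real_inner_smul_left]
      have : 0 ≤ x₂ := by linarith
      have : 0 ≤ x₁ := by linarith
      positivity
    linarith
  push Not at hx3
  have ha1 : 0 ≤ x₁ + c * (x₂ + x₃) := by nlinarith
  by_cases hv : (x₁ + c * (x₂ + x₃)) ^ 2 * (1 + c) < (1 - c) * (1 + 2 * c)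
  · obtain ⟨e1, e2⟩ := caseC c x₁ x₂ x₃ hc0 hc1 h12 h23 hq3 hx3 (by linarith) hv
    have hc' : 0 < 1 + c := by linarith
    refine sub_bound (x := ((x₁ + c / (1 + c) * x₃)) • v₁ + (x₂ + c / (1 + c) * x₃) • v₂) hm hr1 ?_ ?_
    · simp only [inner_add_left, real_inner_smul_left]
      have e3 : 0 ≤ x₂ + c / (1 + c) * x₃ := by
        have : x₂ + c / (1 + c) * x₃ = ((1 + c) * x₂ + c * x₃) / (1 + c) := by field_simp
        rw [this]; positivity
      have e4 : 0 ≤ x₁ + c / (1 + c) * x₃ := by linarith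
      positivity
    · have : q - ((x₁ + c / (1 + c) * x₃) • v₁ + (x₂ + c / (1 + c) * x₃) • v₂)
          = (-(c / (1 + c) * x₃)) • v₁ + (-(c / (1 + c) * x₃)) • v₂ + x₃ • v₃ := by
        rw [hq]; module
      rw [this, h.inner_comb, mcos_sq hc0, le_div_iff₀ hc']
      refine le_trans (le_of_eq ?_) e2
      field_simp
      ring
  · push Not at hv
    refine sub_bound (x := (x₁ + c * (x₂ + x₃)) • v₁) hm hr1 ?_ ?_
    · rw [real_inner_smul_left]; positivity
    · have : q - (x₁ + c * (x₂ + x₃)) • v₁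
          = (x₁ - (x₁ + c * (x₂ + x₃))) • v₁ + x₂ • v₂ + x₃ • v₃ := by
        rw [hq]; module
      rw [this, h.inner_comb, mcos_sq hc0, le_div_iff₀ (by linarith)]
      nlinarith

lemma Gram.basis (hind : LinearIndependent ℝ ![v₁, v₂, v₃]) (q : E 2) :
    ∃ x₁ x₂ x₃ : ℝ, q = x₁ • v₁ + x₂ • v₂ + x₃ • v₃ := by
  let b := basisOfLinearIndependentOfCardEqFinrank hind (by simp)
  have := b.sum_repr q
  simp only [b, coe_basisOfLinearIndependentOfCardEqFinrank, Fin.sum_univ_three] at this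
  exact ⟨_, _, _, this.symm⟩

lemma polar_bound (h : Gram v₁ v₂ v₃ c) (hind : LinearIndependent ℝ ![v₁, v₂, v₃])
    (hc0 : 0 ≤ c) (hc1 : c < 1) {q r : E 2}
    (hq1 : ‖q‖ = 1) (hr1 : ‖r‖ = 1)
    (q1 : 0 ≤ ⟪q, v₁⟫) (q2 : 0 ≤ ⟪q, v₂⟫) (q3 : 0 ≤ ⟪q, v₃⟫)
    (r1 : 0 ≤ ⟪r, v₁⟫) (r2 : 0 ≤ ⟪r, v₂⟫) (r3 : 0 ≤ ⟪r, v₃⟫) :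
    -⟪q, r⟫ ≤ mcos c := by
  obtain ⟨x₁, x₂, x₃, hq⟩ := Gram.basis hind q
  rcases le_total x₁ x₂ with a | a <;> rcases le_total x₂ x₃ with b | b <;>
    rcases le_total x₁ x₃ with d | d
  · exact sorted_bound h.swap12.swap23.swap12 hc0 hc1 hq1 hr1 q1 r3 r2 r1 (by rw [hq]; module) b a
  · exact sorted_bound h.swap12.swap23.swap12 hc0 hc1 hq1 hr1 q1 r3 r2 r1 (by rw [hq]; module) b a
  · exact sorted_bound h.swap12.swap23 hc0 hc1 hq1 hr1 q1 r2 r3 r1 (by rw [hq]; module) b d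
  · exact sorted_bound h.swap12 hc0 hc1 hq1 hr1 q3 r2 r1 r3 (by rw [hq]; module) a d
  · exact sorted_bound h.swap23.swap12 hc0 hc1 hq1 hr1 q2 r3 r1 r2 (by rw [hq]; module) d a
  · exact sorted_bound h.swap23 hc0 hc1 hq1 hr1 q2 r1 r3 r2 (by rw [hq]; module) d b
  · exact sorted_bound h hc0 hc1 hq1 hr1 q3 r1 r2 r3 hq a b
  · exact sorted_bound h hc0 hc1 hq1 hr1 q3 r1 r2 r3 hq a b

lemma polar_bound_neg (h : Gram v₁ v₂ v₃ c) (hind : LinearIndependent ℝ ![v₁, v₂, v₃])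
    (hc0 : c < 0) (hc1 : -1 / 2 < c) {q r : E 2}
    (hq1 : ‖q‖ = 1) (hr1 : ‖r‖ = 1)
    (q1 : 0 ≤ ⟪q, v₁⟫) (q2 : 0 ≤ ⟪q, v₂⟫) (q3 : 0 ≤ ⟪q, v₃⟫)
    (r1 : 0 ≤ ⟪r, v₁⟫) (r2 : 0 ≤ ⟪r, v₂⟫) (r3 : 0 ≤ ⟪r, v₃⟫) :
    -⟪q, r⟫ ≤ c / (1 + c) := by
  obtain ⟨x₁, x₂, x₃, hq⟩ := Gram.basis hind q
  obtain ⟨y₁, y₂, y₃, hr⟩ := Gram.basis hind r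
  have nq := inner_self_one hq1
  have nr := inner_self_one hr1
  rw [hq, h.inner_comb] at nq
  rw [hr, h.inner_comb] at nr
  have hqr := h.inner_comb x₁ x₂ x₃ y₁ y₂ y₃
  rw [← hq, ← hr] at hqr
  rw [hqr]
  rw [hq] at q1 q2 q3
  rw [hr] at r1 r2 r3
  rw [h.inner_comb_one] at q1 r1
  rw [h.inner_comb_two] at q2 r2
  rw [h.inner_comb_three] at q3 r3
  have hD : 0 < (1 - c) * (1 + 2 * c) := mul_pos (by linarith) (by linarith)
  obtain ⟨a₁, ha₁⟩ : ∃ a, a = x₁ + c * (x₂ + x₃) := ⟨_, rfl⟩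
  obtain ⟨a₂, ha₂⟩ : ∃ a, a = x₂ + c * (x₁ + x₃) := ⟨_, rfl⟩
  obtain ⟨a₃, ha₃⟩ : ∃ a, a = x₃ + c * (x₁ + x₂) := ⟨_, rfl⟩
  obtain ⟨b₁, hb₁⟩ : ∃ a, a = y₁ + c * (y₂ + y₃) := ⟨_, rfl⟩
  obtain ⟨b₂, hb₂⟩ : ∃ a, a = y₂ + c * (y₁ + y₃) := ⟨_, rfl⟩
  obtain ⟨b₃, hb₃⟩ : ∃ a, a = y₃ + c * (y₁ + y₂) := ⟨_, rfl⟩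
  have aux : ∀ z₁ z₂ z₃ : ℝ, 0 ≤ z₁ → 0 ≤ z₂ → 0 ≤ z₃ →
      (1 + 2 * c) * (z₁ ^ 2 + z₂ ^ 2 + z₃ ^ 2) - c * (z₁ + z₂ + z₃) ^ 2 = (1 - c) * (1 + 2 * c) →
      (1 - c) * (1 + 2 * c) ≤ (1 + c) * (z₁ + z₂ + z₃) ^ 2 := by
    intro z₁ z₂ z₃ h1 h2 h3 h4
    have : 0 ≤ z₁ * z₂ + z₁ * z₃ + z₂ * z₃ := by positivity
    have : 0 ≤ (1 + 2 * c) * (z₁ * z₂ + z₁ * z₃ + z₂ * z₃) := mul_nonneg (by linarith) this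
    nlinarith
  have hA := aux a₁ a₂ a₃ (ha₁ ▸ q1) (ha₂ ▸ q2) (ha₃ ▸ q3) (by
    rw [ha₁, ha₂, ha₃]; linear_combination ((1 - c) * (1 + 2 * c)) * nq)
  have hB := aux b₁ b₂ b₃ (hb₁ ▸ r1) (hb₂ ▸ r2) (hb₃ ▸ r3) (by
    rw [hb₁, hb₂, hb₃]; linear_combination ((1 - c) * (1 + 2 * c)) * nr)
  rw [← ha₁] at q1
  rw [← ha₂] at q2
  rw [← ha₃] at q3
  rw [← hb₁] at r1
  rw [← hb₂] at r2
  rw [← hb₃] at r3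
  have hAB : (1 - c) * (1 + 2 * c) ≤ (1 + c) * ((a₁ + a₂ + a₃) * (b₁ + b₂ + b₃)) := by
    have hc' : 0 < 1 + c := by linarith
    have : ((1 - c) * (1 + 2 * c)) ^ 2 ≤ ((1 + c) * ((a₁ + a₂ + a₃) * (b₁ + b₂ + b₃))) ^ 2 := by
      calc ((1 - c) * (1 + 2 * c)) ^ 2 = ((1 - c) * (1 + 2 * c)) * ((1 - c) * (1 + 2 * c)) := sq _
        _ ≤ ((1 + c) * (a₁ + a₂ + a₃) ^ 2) * ((1 + c) * (b₁ + b₂ + b₃) ^ 2) :=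
          mul_le_mul hA hB hD.le (by positivity)
        _ = _ := by ring
    exact (sq_le_sq₀ hD.le (by positivity)).1 this
  rw [le_div_iff₀ (by linarith)]
  have hS : 0 ≤ (1 + 2 * c) * (a₁ * b₁ + a₂ * b₂ + a₃ * b₃) :=
    mul_nonneg (by linarith) (by positivity)
  obtain ⟨I, hI⟩ : ∃ I, I = x₁ * y₁ + x₂ * y₂ + x₃ * y₃ +
      c * (x₁ * y₂ + x₂ * y₁ + x₁ * y₃ + x₃ * y₁ + x₂ * y₃ + x₃ * y₂) := ⟨_, rfl⟩
  rw [← hI]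
  have hid : (1 - c) * (1 + 2 * c) * I = (1 + 2 * c) * (a₁ * b₁ + a₂ * b₂ + a₃ * b₃)
      - c * ((a₁ + a₂ + a₃) * (b₁ + b₂ + b₃)) := by
    rw [hI, ha₁, ha₂, ha₃, hb₁, hb₂, hb₃]; ring
  have h5 : ((1 - c) * (1 + 2 * c)) * (-I * (1 + c)) ≤ ((1 - c) * (1 + 2 * c)) * c := by
    have hS' := mul_nonneg (by linarith : (0 : ℝ) ≤ 1 + c) hS
    have hAB' := mul_le_mul_of_nonneg_left hAB (by linarith : (0 : ℝ) ≤ -c)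
    have e : ((1 - c) * (1 + 2 * c)) * (-I * (1 + c)) = -(1 + c) *
        ((1 + 2 * c) * (a₁ * b₁ + a₂ * b₂ + a₃ * b₃) - c * ((a₁ + a₂ + a₃) * (b₁ + b₂ + b₃))) := by
      rw [← hid]; ring
    rw [e]
    clear hA hB nq nr aux hid e hqr
    linarith
  exact le_of_mul_le_mul_left h5 hD

end SphericalPal
namespace SphericalPal

variable {v₁ v₂ v₃ : E 2} {c : ℝ}

lemma ind_zero (hind : LinearIndependent ℝ ![v₁, v₂, v₃]) {a b d : ℝ}
    (h : a • v₁ + b • v₂ + d • v₃ = 0) : a = 0 ∧ b = 0 ∧ d = 0 := by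
  have := Fintype.linearIndependent_iff.1 hind ![a, b, d] (by
    simpa [Fin.sum_univ_three] using h)
  exact ⟨this 0, this 1, this 2⟩

lemma Gram.lt_one (h : Gram v₁ v₂ v₃ c) (hind : LinearIndependent ℝ ![v₁, v₂, v₃]) : c < 1 := by
  have h1 := h.inner_comb 1 (-1) 0 1 (-1) 0
  have h2 : (1 : ℝ) • v₁ + (-1 : ℝ) • v₂ + (0 : ℝ) • v₃ ≠ 0 := fun h0 => by
    have := (ind_zero hind h0).1
    norm_num at this
  have h3 := real_inner_self_pos.2 h2
  rw [h1] at h3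
  linarith

lemma Gram.gt (h : Gram v₁ v₂ v₃ c) (hind : LinearIndependent ℝ ![v₁, v₂, v₃]) :
    -1 / 2 < c := by
  have h1 := h.inner_comb 1 1 1 1 1 1
  have h2 : (1 : ℝ) • v₁ + (1 : ℝ) • v₂ + (1 : ℝ) • v₃ ≠ 0 := fun h0 => by
    have := (ind_zero hind h0).1
    norm_num at this
  have h3 := real_inner_self_pos.2 h2
  rw [h1] at h3
  linarith

lemma exists_gram (h₁ : v₁ ∈ unitSphere 2) (h₂ : v₂ ∈ unitSphere 2) (h₃ : v₃ ∈ unitSphere 2)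
    (heq : gdist v₁ v₂ = gdist v₂ v₃ ∧ gdist v₂ v₃ = gdist v₁ v₃) :
    ∃ c, Gram v₁ v₂ v₃ c := by
  rw [mem_unitSphere_iff] at h₁ h₂ h₃
  obtain ⟨e1, e2⟩ := heq
  have a := inner_mem_Icc h₁ h₂
  have b := inner_mem_Icc h₂ h₃
  have d := inner_mem_Icc h₁ h₃
  have e1' := (Real.arccos_inj a.1 a.2 b.1 b.2).1 e1
  have e2' := (Real.arccos_inj b.1 b.2 d.1 d.2).1 e2
  exact ⟨⟪v₁, v₂⟫, h₁, h₂, h₃, rfl, e1'.symm, by rw [e1', e2']⟩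

lemma Gram.hemi (h : Gram v₁ v₂ v₃ c) (hc : -1 / 2 < c) :
    0 < ⟪v₁ + v₂ + v₃, v₁⟫ ∧ 0 < ⟪v₁ + v₂ + v₃, v₂⟫ ∧ 0 < ⟪v₁ + v₂ + v₃, v₃⟫ := by
  have h1 := h.inner_comb_one 1 1 1
  have h2 := h.inner_comb_two 1 1 1
  have h3 := h.inner_comb_three 1 1 1
  simp only [one_smul] at h1 h2 h3
  rw [h1, h2, h3]
  refine ⟨?_, ?_, ?_⟩ <;> linarith

lemma supp_unpack {K : Set (E 2)} {u v : E 2} (h : IsSupportingLune K u v) :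
    ‖u‖ = 1 ∧ ‖v‖ = 1 ∧ breadth u v = Real.arccos (-⟪u, v⟫) ∧
    ∀ x ∈ K, 0 ≤ ⟪-u, x⟫ ∧ 0 ≤ ⟪-v, x⟫ := by
  obtain ⟨hu, hv, h1, h2, h3, -⟩ := h
  rw [mem_unitSphere_iff] at hu hv
  refine ⟨hu, hv, breadth_eq hu hv h1 h2, fun x hx => ?_⟩
  obtain ⟨-, h4, h5⟩ := h3 hx
  rw [inner_neg_left, inner_neg_left, real_inner_comm, real_inner_comm x v]
  constructor <;> linarith

lemma nonneg_of_width (h : Gram v₁ v₂ v₃ c) (hind : LinearIndependent ℝ ![v₁, v₂, v₃]) {w : ℝ}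
    (hw0 : 0 < w) (hw : w ≤ π / 2) (hT : width (sconv {v₁, v₂, v₃}) = w) : 0 ≤ c := by
  by_contra hc
  push Not at hc
  have hc2 := h.gt hind
  have hne : {b | ∃ u v : E 2, IsSupportingLune (sconv {v₁, v₂, v₃}) u v ∧ b = breadth u v}.Nonempty := by
    by_contra hemp
    rw [Set.not_nonempty_iff_eq_empty] at hemp
    rw [width, hemp, Real.sInf_empty] at hT
    linarith
  have hneg : c / (1 + c) < 0 := div_neg_of_neg_of_pos hc (by linarith)
  have hgt : π / 2 < Real.arccos (c / (1 + c)) := by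
    rw [← not_le, Real.arccos_le_pi_div_two]; linarith
  have : Real.arccos (c / (1 + c)) ≤ width (sconv {v₁, v₂, v₃}) := by
    refine le_csInf hne ?_
    rintro b ⟨u, v, huv, rfl⟩
    obtain ⟨hu, hv, hb, hx⟩ := supp_unpack huv
    have s1 := hx v₁ (subset_sconv _ (by simp))
    have s2 := hx v₂ (subset_sconv _ (by simp))
    have s3 := hx v₃ (subset_sconv _ (by simp))
    rw [hb]
    refine Real.arccos_le_arccos ?_
    have := polar_bound_neg h hind hc hc2 (q := -u) (r := -v) (by rwa [norm_neg])
      (by rwa [norm_neg]) s1.1 s2.1 s3.1 s1.2 s2.2 s3.2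
    rwa [inner_neg_neg] at this
  linarith

lemma width_eq (h : Gram v₁ v₂ v₃ c) (hind : LinearIndependent ℝ ![v₁, v₂, v₃])
    (hc0 : 0 ≤ c) {y u : E 2} (hy : ‖y‖ = 1)
    (hu1 : 0 < ⟪u, v₁⟫) (hu2 : 0 < ⟪u, v₂⟫) (huy : 0 < ⟪u, y⟫)
    {l k : ℝ} (hl : 0 ≤ l) (hk : 0 ≤ k) (hv3 : v₃ = l • v₂ + k • y)
    {s t : ℝ} (hyst : y = s • v₂ + t • v₃)
    (hV : ⟪(2 * c) • v₁ + (-1 : ℝ) • v₂ + (-1 : ℝ) • v₃, y⟫ ≤ 0) :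
    width (sconv {v₁, v₂, y}) = Real.arccos (mcos c) := by
  have hc1 := h.lt_one hind
  have hcone := sconv_subset_cone h.n1 h.n2 hy hu1 hu2 huy
  refine IsLeast.csInf_eq ⟨?_, ?_⟩
  · set V := (2 * c) • v₁ + (-1 : ℝ) • v₂ + (-1 : ℝ) • v₃ with hVdef
    set U := (-1 : ℝ) • v₁ + (c / (1 + c)) • v₂ + (c / (1 + c)) • v₃ with hUdef
    have hc' : 0 < 1 + c := by linarith
    have hD : 0 < (1 - c) * (1 + 2 * c) := mul_pos (by linarith) (by linarith)
    have U1 : ⟪U, v₁⟫ = -((1 - c) * (1 + 2 * c) / (1 + c)) := by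
      rw [hUdef, h.inner_comb_one]; field_simp; ring
    have U2 : ⟪U, v₂⟫ = 0 := by
      rw [hUdef, h.inner_comb_two]; field_simp; ring
    have U3 : ⟪U, v₃⟫ = 0 := by
      rw [hUdef, h.inner_comb_three]; field_simp; ring
    have V1 : ⟪V, v₁⟫ = 0 := by
      rw [hVdef, h.inner_comb_one]; ring
    have V2 : ⟪V, v₂⟫ ≤ 0 := by
      rw [hVdef, h.inner_comb_two]; nlinarith
    have Uy : ⟪U, y⟫ = 0 := by
      rw [hyst, inner_add_right, real_inner_smul_right, real_inner_smul_right, U2, U3]; simp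
    have UU : ‖U‖ ^ 2 = (1 - c) * (1 + 2 * c) / (1 + c) := by
      rw [← real_inner_self_eq_norm_sq, hUdef, h.inner_comb]; field_simp; ring
    have VV : ‖V‖ ^ 2 = 2 * ((1 - c) * (1 + 2 * c)) := by
      rw [← real_inner_self_eq_norm_sq, hVdef, h.inner_comb]; ring
    have UV : ⟪U, V⟫ = -(2 * c) * ((1 - c) * (1 + 2 * c) / (1 + c)) := by
      rw [hUdef, hVdef, h.inner_comb]; field_simp; ring
    have hU0 : 0 < ‖U‖ := by
      rw [norm_pos_iff]; rintro h0
      rw [h0] at UU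
      have : 0 < (1 - c) * (1 + 2 * c) / (1 + c) := by positivity
      simp at UU; linarith
    have hV0 : 0 < ‖V‖ := by
      rw [norm_pos_iff]; rintro h0
      rw [h0] at VV
      rw [norm_zero] at VV; nlinarith
    have nU : ‖‖U‖⁻¹ • U‖ = 1 := norm_smul_inv_norm (norm_pos_iff.1 hU0)
    have nV : ‖‖V‖⁻¹ • V‖ = 1 := norm_smul_inv_norm (norm_pos_iff.1 hV0)
    have hU1' : ⟪‖U‖⁻¹ • U, v₁⟫ < 0 := by
      rw [real_inner_smul_left, U1]
      have : 0 < ‖U‖⁻¹ * ((1 - c) * (1 + 2 * c) / (1 + c)) := by positivity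
      linarith
    have hne1 : ‖U‖⁻¹ • U ≠ ‖V‖⁻¹ • V := fun he => by
      rw [he, real_inner_smul_left, V1] at hU1'; simp at hU1'
    have hne2 : ‖U‖⁻¹ • U ≠ -(‖V‖⁻¹ • V) := fun he => by
      rw [he, inner_neg_left, real_inner_smul_left, V1] at hU1'; simp at hU1'
    have hU1'' : ⟪U, v₁⟫ ≤ 0 := by
      rw [U1]
      have : 0 < ((1 - c) * (1 + 2 * c) / (1 + c)) := by positivity
      linarith
    have neg : ∀ {W : E 2} (x : E 2), ⟪W, x⟫ ≤ 0 → ⟪x, ‖W‖⁻¹ • W⟫ ≤ 0 := by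
      intro W x hx
      rw [real_inner_comm, real_inner_smul_left]
      exact mul_nonpos_of_nonneg_of_nonpos (by positivity) hx
    refine ⟨‖U‖⁻¹ • U, ‖V‖⁻¹ • V, ⟨mem_unitSphere_iff.2 nU, mem_unitSphere_iff.2 nV, hne1, hne2,
      ?_, ⟨v₂, subset_sconv _ (by simp), mem_unitSphere_iff.2 h.n2, ?_, neg _ V2⟩,
        ⟨v₁, subset_sconv _ (by simp), mem_unitSphere_iff.2 h.n1, ?_, neg _ hU1''⟩⟩, ?_⟩
    · intro x hx
      obtain ⟨hx1, a, b, d, ha, hb, hd, rfl⟩ := hcone x hx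
      refine ⟨mem_unitSphere_iff.2 hx1, neg _ ?_, neg _ ?_⟩
      · simp only [inner_add_right, real_inner_smul_right, U2, Uy]
        nlinarith
      · simp only [inner_add_right, real_inner_smul_right, V1]
        nlinarith
    · rw [real_inner_comm, real_inner_smul_left, U2, mul_zero]
    · rw [real_inner_comm, real_inner_smul_left, V1, mul_zero]
    · rw [breadth_eq nU nV hne1 hne2]
      congr 1
      rw [real_inner_smul_left, real_inner_smul_right, UV]
      have : ‖V‖ = ‖U‖ * √(2 * (1 + c)) := by
        rw [← sq_eq_sq₀ (norm_nonneg _) (by positivity), mul_pow, Real.sq_sqrt (by positivity), UU, VV]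
        field_simp
      rw [this, ← UU, mcos]
      field_simp
  · rintro b ⟨u', v', huv, rfl⟩
    obtain ⟨hu, hv, hb, hx⟩ := supp_unpack huv
    have s1 := hx v₁ (subset_sconv _ (by simp))
    have s2 := hx v₂ (subset_sconv _ (by simp))
    have sy := hx y (subset_sconv _ (by simp))
    rw [hb]
    refine Real.arccos_le_arccos ?_
    have := polar_bound h hind hc0 hc1 (q := -u') (r := -v') (by rwa [norm_neg])
      (by rwa [norm_neg]) s1.1 s2.1 ?_ s1.2 s2.2 ?_
    · rwa [inner_neg_neg] at this
    · rw [hv3, inner_add_right, real_inner_smul_right, real_inner_smul_right]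
      exact add_nonneg (mul_nonneg hl s2.1) (mul_nonneg hk sy.1)
    · rw [hv3, inner_add_right, real_inner_smul_right, real_inner_smul_right]
      exact add_nonneg (mul_nonneg hl s2.2) (mul_nonneg hk sy.2)

lemma V_three (h : Gram v₁ v₂ v₃ c) :
    ⟪(2 * c) • v₁ + (-1 : ℝ) • v₂ + (-1 : ℝ) • v₃, v₃⟫ = -((1 - c) * (1 + 2 * c)) := by
  rw [h.inner_comb_three]; ring

lemma width_regular (h : Gram v₁ v₂ v₃ c) (hind : LinearIndependent ℝ ![v₁, v₂, v₃])
    (hc0 : 0 ≤ c) : width (sconv {v₁, v₂, v₃}) = Real.arccos (mcos c) := by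
  obtain ⟨a, b, d⟩ := h.hemi (h.gt hind)
  refine width_eq h hind hc0 h.n3 a b d (l := 0) (k := 1) le_rfl zero_le_one (by simp)
    (s := 0) (t := 1) (by simp) ?_
  rw [V_three h]
  have := h.lt_one hind
  have : 0 < (1 - c) * (1 + 2 * c) := mul_pos (by linarith) (by linarith)
  linarith

lemma mcos_le_one (hc0 : 0 ≤ c) (hc1 : c < 1) : mcos c ≤ 1 := by
  have h1 := mcos_sq hc0
  have : mcos c ^ 2 ≤ 1 := by
    rw [h1, div_le_one (by linarith)]; nlinarith
  nlinarith [mcos_nonneg hc0]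

lemma mcos_inj {c' : ℝ} (hc0 : 0 ≤ c) (hc1 : c < 1) (hc0' : 0 ≤ c') (hc1' : c' < 1)
    (h : Real.arccos (mcos c) = Real.arccos (mcos c')) : c = c' := by
  have e := (Real.arccos_inj (by linarith [mcos_nonneg hc0]) (mcos_le_one hc0 hc1)
    (by linarith [mcos_nonneg hc0']) (mcos_le_one hc0' hc1')).1 h
  have e2 : 2 * c ^ 2 / (1 + c) = 2 * c' ^ 2 / (1 + c') := by
    rw [← mcos_sq hc0, ← mcos_sq hc0', e]
  rw [div_eq_div_iff (by linarith) (by linarith)] at e2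
  have e3 : (c - c') * (c + c' + c * c') = 0 := by linear_combination e2 / 2
  rcases mul_eq_zero.1 e3 with h | h
  · linarith
  · have : 0 ≤ c * c' := by positivity
    linarith

lemma inner_ge_of_mem (h : Gram v₁ v₂ v₃ c) (hind : LinearIndependent ℝ ![v₁, v₂, v₃])
    (hc0 : 0 ≤ c) {x z : E 2} (hx : x ∈ sconv {v₁, v₂, v₃}) (hz : z ∈ sconv {v₁, v₂, v₃}) :
    ‖x‖ = 1 ∧ ‖z‖ = 1 ∧ c ≤ ⟪x, z⟫ := by
  obtain ⟨a, b, d⟩ := h.hemi (h.gt hind)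
  obtain ⟨hx1, a₁, a₂, a₃, p1, p2, p3, hx'⟩ := sconv_subset_cone h.n1 h.n2 h.n3 a b d x hx
  obtain ⟨hz1, b₁, b₂, b₃, q1, q2, q3, hz'⟩ := sconv_subset_cone h.n1 h.n2 h.n3 a b d z hz
  refine ⟨hx1, hz1, ?_⟩
  have hc1 := h.lt_one hind
  have aux : ∀ (z : E 2) (a₁ a₂ a₃ : ℝ), 0 ≤ a₁ → 0 ≤ a₂ → 0 ≤ a₃ → ‖z‖ = 1 →
      z = a₁ • v₁ + a₂ • v₂ + a₃ • v₃ → 1 ≤ a₁ + a₂ + a₃ := by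
    intro z a₁ a₂ a₃ p1 p2 p3 hz hz'
    rw [← hz, hz']
    refine (norm_add₃_le).trans ?_
    simp [norm_smul, h.n1, h.n2, h.n3, abs_of_nonneg, p1, p2, p3]
  have hA := aux x a₁ a₂ a₃ p1 p2 p3 hx1 hx'
  have hB := aux z b₁ b₂ b₃ q1 q2 q3 hz1 hz'
  have hAB : 1 ≤ (a₁ + a₂ + a₃) * (b₁ + b₂ + b₃) := by nlinarith
  rw [hx', hz', h.inner_comb]
  have : 0 ≤ (1 - c) * (a₁ * b₁ + a₂ * b₂ + a₃ * b₃) :=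
    mul_nonneg (by linarith) (by positivity)
  nlinarith

end SphericalPal
namespace SphericalPal

variable {v₁ v₂ v₃ : E 2} {c : ℝ}

lemma normalize_lip {x y : E 2} (hx : 1 / 6 ≤ ‖x‖) (hy : 1 / 6 ≤ ‖y‖) :
    ‖‖x‖⁻¹ • x - ‖y‖⁻¹ • y‖ ≤ 12 * ‖x - y‖ := by
  have hx0 : 0 < ‖x‖ := by linarith
  have hy0 : 0 < ‖y‖ := by linarith
  have e : ‖x‖⁻¹ • x - ‖y‖⁻¹ • y = ‖x‖⁻¹ • (x - y) + (‖x‖⁻¹ - ‖y‖⁻¹) • y := by module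
  have h1 : ‖(‖x‖⁻¹ - ‖y‖⁻¹) • y‖ ≤ ‖x‖⁻¹ * ‖x - y‖ := by
    rw [norm_smul, Real.norm_eq_abs]
    have : ‖x‖⁻¹ - ‖y‖⁻¹ = ‖x‖⁻¹ * (‖y‖ - ‖x‖) * ‖y‖⁻¹ := by field_simp
    rw [this, abs_mul, abs_mul, abs_of_pos (inv_pos.2 hx0), abs_of_pos (inv_pos.2 hy0),
      mul_assoc, inv_mul_cancel₀ hy0.ne', mul_one, norm_sub_rev x y]
    exact mul_le_mul_of_nonneg_left (abs_norm_sub_norm_le _ _) (by positivity)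
  have h2 : ‖x‖⁻¹ ≤ 6 := by
    rw [inv_le_comm₀ hx0 (by norm_num)]; linarith
  have h3 : ‖x‖⁻¹ * ‖x - y‖ ≤ 6 * ‖x - y‖ := mul_le_mul_of_nonneg_right h2 (norm_nonneg _)
  rw [e]
  refine (norm_add_le _ _).trans ?_
  rw [norm_smul, norm_inv, norm_norm]
  linarith

lemma cone_measure {p q r n : E 2} (hp1 : ‖p‖ = 1) (hq1 : ‖q‖ = 1) (hr1 : ‖r‖ = 1)
    (hn : ‖n‖ ≤ 3) (hp : 1 / 2 ≤ ⟪n, p⟫) (hq : 1 / 2 ≤ ⟪n, q⟫) (hr : 1 / 2 ≤ ⟪n, r⟫) :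
    μH[2] {x : E 2 | ‖x‖ = 1 ∧ x ∈ cone3 p q r} ≤ ENNReal.ofReal (3600 * ‖r - q‖) := by
  obtain ⟨L, hL⟩ : ∃ L, L = ‖r - q‖ := ⟨_, rfl⟩
  have hL0 : 0 ≤ L := hL ▸ norm_nonneg _
  have hL2 : L ≤ 2 := by
    rw [hL]; refine (norm_sub_le _ _).trans ?_
    rw [hr1, hq1]; norm_num
  obtain ⟨e, he⟩ : ∃ e, e = L⁻¹ • (r - q) := ⟨_, rfl⟩
  have he1 : ‖e‖ ≤ 1 := by
    rw [he, norm_smul, norm_inv, Real.norm_of_nonneg hL0, ← hL]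
    exact inv_mul_le_one
  have hLe : L • e = r - q := by
    rw [he, smul_smul]
    by_cases h0 : L = 0
    · have : r - q = 0 := norm_eq_zero.1 (by rw [← hL, h0])
      simp [this]
    · rw [mul_inv_cancel₀ h0, one_smul]
  let G : ℝ × ℝ → E 2 := fun z => p + z.1 • (q - p) + (z.1 * z.2) • e
  let F : ℝ × ℝ → E 2 := fun z => ‖G z‖⁻¹ • G z
  let S : Set (ℝ × ℝ) := Set.Icc 0 1 ×ˢ Set.Icc 0 L
  have hG : ∀ z ∈ S, 1 / 6 ≤ ‖G z‖ := by
    rintro ⟨s, t⟩ ⟨⟨hs0, hs1⟩, ht0, ht1⟩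
    simp only at hs0 hs1 ht0 ht1
    have hτ0 : 0 ≤ t * L⁻¹ := by positivity
    have hτ1 : t * L⁻¹ ≤ 1 := by
      rw [← div_eq_mul_inv]; exact div_le_one_of_le₀ ht1 hL0
    have hGe : G (s, t) = (1 - s) • p + (s * (1 - t * L⁻¹)) • q + (s * (t * L⁻¹)) • r := by
      simp only [G, he]; module
    have h1 : 1 / 2 ≤ ⟪n, G (s, t)⟫ := by
      rw [hGe]
      simp only [inner_add_right, real_inner_smul_right]
      have a1 := mul_le_mul_of_nonneg_left hp (sub_nonneg.2 hs1)
      have a2 := mul_le_mul_of_nonneg_left hq (mul_nonneg hs0 (sub_nonneg.2 hτ1))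
      have a3 := mul_le_mul_of_nonneg_left hr (mul_nonneg hs0 hτ0)
      linarith
    have h2 := real_inner_le_norm n (G (s, t))
    have h3 : ‖n‖ * ‖G (s, t)‖ ≤ 3 * ‖G (s, t)‖ := mul_le_mul_of_nonneg_right hn (norm_nonneg _)
    linarith
  have hlip : LipschitzOnWith 60 F S := by
    refine LipschitzOnWith.of_dist_le_mul ?_
    intro z hz z' hz'
    have h1 := normalize_lip (hG z hz) (hG z' hz')
    have h2 : ‖G z - G z'‖ ≤ 5 * dist z z' := by
      have d1 : |z.1 - z'.1| ≤ dist z z' := by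
        rw [Prod.dist_eq, ← Real.dist_eq]; exact le_max_left _ _
      have d2 : |z.2 - z'.2| ≤ dist z z' := by
        rw [Prod.dist_eq, ← Real.dist_eq z.2]; exact le_max_right _ _
      obtain ⟨⟨hs0, hs1⟩, ht0, ht1⟩ := hz
      obtain ⟨⟨hs0', hs1'⟩, ht0', ht1'⟩ := hz'
      have eG : G z - G z' = (z.1 - z'.1) • (q - p) + ((z.1 - z'.1) * z.2 + z'.1 * (z.2 - z'.2)) • e := by
        simp only [G]; module
      rw [eG]
      refine (norm_add_le _ _).trans ?_
      rw [norm_smul, norm_smul, Real.norm_eq_abs, Real.norm_eq_abs]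
      have hqp : ‖q - p‖ ≤ 2 := by
        refine (norm_sub_le _ _).trans ?_
        rw [hp1, hq1]; norm_num
      have b1 : |z.1 - z'.1| * ‖q - p‖ ≤ dist z z' * 2 :=
        mul_le_mul d1 hqp (norm_nonneg _) dist_nonneg
      have b2 : |(z.1 - z'.1) * z.2 + z'.1 * (z.2 - z'.2)| ≤ dist z z' * 2 + 1 * dist z z' := by
        refine (abs_add_le _ _).trans ?_
        rw [abs_mul, abs_mul, abs_of_nonneg ht0, abs_of_nonneg hs0']
        exact add_le_add (mul_le_mul d1 (ht1.trans hL2) ht0 dist_nonneg)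
          (mul_le_mul hs1' d2 (abs_nonneg _) zero_le_one)
      have b3 : |(z.1 - z'.1) * z.2 + z'.1 * (z.2 - z'.2)| * ‖e‖ ≤ (dist z z' * 2 + 1 * dist z z') * 1 :=
        mul_le_mul b2 he1 (norm_nonneg _) (by positivity)
      linarith
    rw [dist_eq_norm]
    simp only [F]
    push_cast
    linarith
  have hsub : {x : E 2 | ‖x‖ = 1 ∧ x ∈ cone3 p q r} ⊆ F '' S := by
    rintro x ⟨hx1, a, b, d, ha, hb, hd, hx⟩
    have hσ : 0 < a + b + d := by
      rcases (by positivity : 0 ≤ a + b + d).eq_or_lt with h | h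
      · have h1 : a = 0 := by linarith
        have h2 : b = 0 := by linarith
        have h3 : d = 0 := by linarith
        rw [h1, h2, h3] at hx
        simp [hx] at hx1
      · exact h
    refine ⟨((b + d) / (a + b + d), L * (d / (b + d))), ⟨⟨by positivity, ?_⟩, ⟨by positivity, ?_⟩⟩, ?_⟩
    · rw [div_le_one hσ]; linarith
    · exact mul_le_of_le_one_right hL0 (div_le_one_of_le₀ (by linarith) (by positivity))
    · have hGx : G ((b + d) / (a + b + d), L * (d / (b + d))) = (a + b + d)⁻¹ • x := by
        have e1 : (b + d) / (a + b + d) * (L * (d / (b + d))) = d / (a + b + d) * L := by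
          by_cases h0 : b + d = 0
          · have : d = 0 := by linarith
            simp [this]
          · field_simp
        simp only [G]
        rw [e1, mul_smul, hLe, hx]
        have e2 : p = (a + b + d)⁻¹ • ((a + b + d) • p) := by
          rw [smul_smul, inv_mul_cancel₀ hσ.ne', one_smul]
        nth_rewrite 1 [e2]
        rw [div_eq_inv_mul, div_eq_inv_mul]
        module
      simp only [F]
      rw [hGx, norm_smul, hx1, mul_one, norm_inv, Real.norm_of_nonneg hσ.le, inv_inv, smul_smul,
        mul_inv_cancel₀ hσ.ne', one_smul]
  calc μH[2] {x : E 2 | ‖x‖ = 1 ∧ x ∈ cone3 p q r} ≤ μH[2] (F '' S) := measure_mono hsub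
    _ ≤ ((60 : NNReal) : ENNReal) ^ (2 : ℝ) * μH[2] S := hlip.hausdorffMeasure_image_le (by norm_num)
    _ = ENNReal.ofReal (3600 * ‖r - q‖) := by
      rw [hausdorffMeasure_prod_real, Measure.volume_eq_prod, Measure.prod_prod, Real.volume_Icc,
        Real.volume_Icc, ← hL, ENNReal.ofReal_mul (by norm_num)]
      norm_num

lemma ext_unpack {ε : ℝ} {y : E 2} (h₂ : ‖v₂‖ = 1) (h₃ : ‖v₃‖ = 1) (h : ExtPoint v₁ v₂ v₃ ε y) :
    ‖y‖ = 1 ∧ ‖y - v₃‖ ≤ |ε| ∧ gdist v₂ y = gdist v₂ v₃ + ε ∧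
    (∃ s t : ℝ, y = s • v₂ + t • v₃) ∧
    (∃ l k : ℝ, 0 ≤ l ∧ 0 ≤ k ∧ v₃ = l • v₂ + k • y) ∧
    ∃ u : E 2, 0 < ⟪u, v₁⟫ ∧ 0 < ⟪u, v₂⟫ ∧ 0 < ⟪u, y⟫ := by
  obtain ⟨hy, hspan, hd, hseg, u, -, hu1, hu2, huy⟩ := h
  rw [mem_unitSphere_iff] at hy
  refine ⟨hy, ?_, ?_, ?_, seg_comb h₂ hy hu2 huy hseg, u, hu1, hu2, huy⟩
  · rw [← sq_le_sq₀ (norm_nonneg _) (abs_nonneg _), sq_abs, norm_sub_sq_real, hy, h₃]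
    have hin := inner_mem_Icc h₃ hy
    have : ⟪v₃, y⟫ = Real.cos ε := by rw [← hd, gdist, Real.cos_arccos hin.1 hin.2]
    rw [real_inner_comm, this]
    have := Real.one_sub_sq_div_two_le_cos (x := ε)
    linarith
  · rw [← hseg.2, hd]
  · obtain ⟨s, t, hst⟩ := Submodule.mem_span_pair.1 hspan
    exact ⟨s, t, hst.symm⟩

lemma part_two (h : Gram v₁ v₂ v₃ c) (hind : LinearIndependent ℝ ![v₁, v₂, v₃])
    (hc0 : 0 ≤ c) {x y w' : E 2} {ε : ℝ} (hx : ‖x‖ = 1) (hy : ‖y‖ = 1)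
    (hd : gdist x y = Real.arccos c + ε) :
    ε / 2 ≤ hausdorffG (sconv {w', x, y}) (sconv {v₁, v₂, v₃}) := by
  set T := sconv {v₁, v₂, v₃} with hT
  set K := sconv {w', x, y} with hK
  have hne : T.Nonempty := ⟨v₁, subset_sconv _ (by simp)⟩
  have hbdd : BddAbove ((fun x => sdist x T) '' K) := by
    refine ⟨π, ?_⟩
    rintro _ ⟨z, -, rfl⟩
    obtain ⟨t, ht⟩ := hne
    refine (csInf_le ⟨0, ?_⟩ (Set.mem_image_of_mem (gdist z) ht)).trans (Real.arccos_le_pi _)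
    rintro _ ⟨s, -, rfl⟩
    exact Real.arccos_nonneg _
  have hle : ∀ z ∈ K, sdist z T ≤ hausdorffG K T := fun z hz =>
    (le_csSup hbdd (Set.mem_image_of_mem (fun x => sdist x T) hz)).trans (le_max_left _ _)
  have k1 := hle x (subset_sconv _ (by simp))
  have k2 := hle y (subset_sconv _ (by simp))
  have main : ∀ a ∈ T, ∀ b ∈ T, ε ≤ gdist x a + gdist y b := by
    intro a ha b hb
    obtain ⟨ha1, hb1, hab⟩ := inner_ge_of_mem h hind hc0 ha hb
    have t1 := gdist_triangle hx ha1 hy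
    have t2 := gdist_triangle ha1 hb1 hy
    have t3 : gdist a b ≤ Real.arccos c := Real.arccos_le_arccos hab
    rw [gdist_comm b y] at t2
    linarith
  have s1 : ∀ b ∈ T, ε - gdist y b ≤ sdist x T := by
    intro b hb
    refine le_csInf (hne.image _) ?_
    rintro _ ⟨a, ha, rfl⟩
    linarith [main a ha b hb]
  have s2 : ε - sdist x T ≤ sdist y T := by
    refine le_csInf (hne.image _) ?_
    rintro _ ⟨b, hb, rfl⟩
    linarith [s1 b hb]
  linarith

lemma split_cone {y x : E 2} {l k : ℝ} (hl : 0 ≤ l) (hk : 0 < k)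
    (hv3 : v₃ = l • v₂ + k • y) (hx : x ∈ cone3 v₁ v₂ y) :
    x ∈ cone3 v₁ v₂ v₃ ∨ x ∈ cone3 v₁ v₃ y := by
  obtain ⟨a, b, d, ha, hb, hd, rfl⟩ := hx
  by_cases hcmp : d * l ≤ b * k
  · left
    refine ⟨a, b - d / k * l, d / k, ha, ?_, by positivity, ?_⟩
    · have : b - d / k * l = (b * k - d * l) / k := by field_simp
      rw [this]; exact div_nonneg (by linarith) hk.le
    · have e : d • y = (d / k) • (k • y) := by rw [smul_smul, div_mul_cancel₀ _ hk.ne']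
      rw [hv3, e]; module
  · right
    push Not at hcmp
    have hl' : 0 < l := by
      rcases hl.eq_or_lt with h | h
      · rw [← h, mul_zero] at hcmp
        have : 0 ≤ b * k := by positivity
        linarith
      · exact h
    refine ⟨a, b / l, d - b / l * k, ha, by positivity, ?_, ?_⟩
    · have : d - b / l * k = (d * l - b * k) / l := by field_simp
      rw [this]; exact div_nonneg (by linarith) hl
    · have e : b • v₂ = (b / l) • (l • v₂) := by rw [smul_smul, div_mul_cancel₀ _ hl'.ne']
      rw [hv3, e]; module

lemma part_three (h : Gram v₁ v₂ v₃ c) (hind : LinearIndependent ℝ ![v₁, v₂, v₃])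
    (hc0 : 0 ≤ c) {ε : ℝ} (hε0 : 0 < ε) (hε : ε < 1 / 4) {y : E 2} (hext : ExtPoint v₁ v₂ v₃ ε y) :
    area (sconv {v₁, v₂, y}) ≤ area (sconv {v₁, v₂, v₃}) + 3600 * ε := by
  obtain ⟨hy, hyd, -, -, ⟨l, k, hl, hk, hv3⟩, u, hu1, hu2, huy⟩ := ext_unpack h.n2 h.n3 hext
  rw [abs_of_pos hε0] at hyd
  have hk' : 0 < k := by
    rcases hk.eq_or_lt with h0 | h0
    · exfalso
      have : (0 : ℝ) • v₁ + (-l) • v₂ + (1 : ℝ) • v₃ = 0 := by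
        rw [hv3, ← h0]; module
      have := (ind_zero hind this).2.2
      norm_num at this
    · exact h0
  obtain ⟨t1, t2, t3⟩ := h.hemi (h.gt hind)
  have hTfin : μH[2] (sconv {v₁, v₂, v₃}) ≠ ⊤ := by
    have h1 := h.inner_comb_one 1 1 1
    have h2 := h.inner_comb_two 1 1 1
    have h3 := h.inner_comb_three 1 1 1
    simp only [one_smul] at h1 h2 h3
    have hn : ‖v₁ + v₂ + v₃‖ ≤ 3 := by
      refine norm_add₃_le.trans ?_
      rw [h.n1, h.n2, h.n3]; norm_num
    refine ne_top_of_le_ne_top ENNReal.ofReal_ne_top ((measure_mono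
      (sconv_subset_cone h.n1 h.n2 h.n3 t1 t2 t3)).trans
      (cone_measure h.n1 h.n2 h.n3 hn ?_ ?_ ?_))
    · rw [h1]; linarith
    · rw [h2]; linarith
    · rw [h3]; linarith
  have hthin : μH[2] {x : E 2 | ‖x‖ = 1 ∧ x ∈ cone3 v₁ v₃ y} ≤ ENNReal.ofReal (3600 * ε) := by
    have hn : ‖v₁ + v₃‖ ≤ 2 := by
      refine (norm_add_le _ _).trans ?_
      rw [h.n1, h.n3]; norm_num
    have e3 : ⟪v₁ + v₃, v₃⟫ = 1 + c := by
      rw [inner_add_left, h.i13, inner_self_one h.n3]; ring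
    refine (cone_measure h.n1 h.n3 hy (hn.trans (by norm_num)) ?_ ?_ ?_).trans
      (ENNReal.ofReal_le_ofReal (by linarith))
    · rw [inner_add_left, inner_self_one h.n1, real_inner_comm, h.i13]; linarith
    · rw [e3]; linarith
    · have e : ⟪v₁ + v₃, y⟫ = ⟪v₁ + v₃, v₃⟫ + ⟪v₁ + v₃, y - v₃⟫ := by
        rw [← inner_add_right]; congr 1; abel
      have h1 := (abs_le.1 (abs_real_inner_le_norm (v₁ + v₃) (y - v₃))).1
      have h2 : ‖v₁ + v₃‖ * ‖y - v₃‖ ≤ 2 * ε := mul_le_mul hn hyd (norm_nonneg _) (by norm_num)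
      rw [e, e3]; linarith
  have hsub : sconv {v₁, v₂, y} ⊆ sconv {v₁, v₂, v₃} ∪ {x : E 2 | ‖x‖ = 1 ∧ x ∈ cone3 v₁ v₃ y} := by
    intro x hx
    obtain ⟨hx1, hx2⟩ := sconv_subset_cone h.n1 h.n2 hy hu1 hu2 huy x hx
    rcases split_cone hl hk' hv3 hx2 with h' | h'
    · exact Or.inl (cone_subset_sconv h.n1 h.n2 h.n3 hx1 h')
    · exact Or.inr ⟨hx1, h'⟩
  have hle : μH[2] (sconv {v₁, v₂, y}) ≤ μH[2] (sconv {v₁, v₂, v₃}) + ENNReal.ofReal (3600 * ε) :=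
    (measure_mono hsub).trans ((measure_union_le _ _).trans (add_le_add le_rfl hthin))
  unfold area
  have := ENNReal.toReal_mono (ENNReal.add_ne_top.2 ⟨hTfin, ENNReal.ofReal_ne_top⟩) hle
  rwa [ENNReal.toReal_add hTfin ENNReal.ofReal_ne_top, ENNReal.toReal_ofReal (by positivity)] at this

end SphericalPal

/-- the "almost regular" triangles `K_ε = [v₁, v₂, v₃^ε]` satisfy:
(1) `w(K_ε) = w` for small `ε`; (2) `δ(K_ε, T) ≥ ε/2` for every regular triangle `T` of
width `w`; (3) `area K_ε ≤ area T_w + c_w·ε` for small `ε`. -/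
theorem almost_regular_triangle (w : ℝ) (hw0 : 0 < w) (hw : w ≤ π / 2)
    (v₁ v₂ v₃ : E 2)
    (h₁ : v₁ ∈ unitSphere 2) (h₂ : v₂ ∈ unitSphere 2) (h₃ : v₃ ∈ unitSphere 2)
    (hind : LinearIndependent ℝ ![v₁, v₂, v₃])
    (heq : gdist v₁ v₂ = gdist v₂ v₃ ∧ gdist v₂ v₃ = gdist v₁ v₃)
    (hTw : width (sconv {v₁, v₂, v₃}) = w) :
    (∃ εw > 0, ∀ ε, 0 < ε → ε < εw → ∀ y : E 2, ExtPoint v₁ v₂ v₃ ε y →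
        width (sconv {v₁, v₂, y}) = w) ∧
    (∀ ε > 0, ∀ y : E 2, ExtPoint v₁ v₂ v₃ ε y →
        ∀ T : Set (E 2), IsRegularTriangle T → width T = w →
          ε / 2 ≤ hausdorffG (sconv {v₁, v₂, y}) T) ∧
    (∃ c > 0, ∃ εw > 0, ∀ ε, 0 < ε → ε < εw → ∀ y : E 2, ExtPoint v₁ v₂ v₃ ε y →
        area (sconv {v₁, v₂, y}) ≤ area (sconv {v₁, v₂, v₃}) + c * ε) := by
  obtain ⟨c, h⟩ := exists_gram h₁ h₂ h₃ heq
  have hc0 : 0 ≤ c := nonneg_of_width h hind hw0 hw hTw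
  have hc1 : c < 1 := h.lt_one hind
  have hwc : w = Real.arccos (mcos c) := by rw [← hTw, width_regular h hind hc0]
  refine ⟨?_, ?_, 3600, by norm_num, 1 / 4, by norm_num, fun ε hε0 hε y hy =>
    part_three h hind hc0 hε0 hε hy⟩
  · set V := (2 * c) • v₁ + (-1 : ℝ) • v₂ + (-1 : ℝ) • v₃ with hV
    have hD : 0 < (1 - c) * (1 + 2 * c) := mul_pos (by linarith) (by linarith)
    refine ⟨(1 - c) * (1 + 2 * c) / (‖V‖ + 1), by positivity, fun ε hε0 hε y hext => ?_⟩
    obtain ⟨hy, hyd, -, ⟨s, t, hst⟩, ⟨l, k, hl, hk, hv3⟩, u, hu1, hu2, huy⟩ :=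
      ext_unpack h.n2 h.n3 hext
    rw [abs_of_pos hε0] at hyd
    rw [hwc]
    refine width_eq h hind hc0 hy hu1 hu2 huy hl hk hv3 hst ?_
    rw [← hV]
    have e : ⟪V, y⟫ = ⟪V, v₃⟫ + ⟪V, y - v₃⟫ := by
      rw [← inner_add_right]; congr 1; abel
    have e3 : ⟪V, v₃⟫ = -((1 - c) * (1 + 2 * c)) := V_three h
    have g1 := real_inner_le_norm V (y - v₃)
    have g2 : ‖V‖ * ‖y - v₃‖ ≤ ‖V‖ * ε := mul_le_mul_of_nonneg_left hyd (norm_nonneg _)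
    rw [lt_div_iff₀ (by positivity)] at hε
    rw [e, e3]
    nlinarith
  · rintro ε - y hext T ⟨a₁, a₂, a₃, ha₁, ha₂, ha₃, haind, haeq1, haeq2, rfl⟩ hTw'
    obtain ⟨c', h'⟩ := exists_gram ha₁ ha₂ ha₃ ⟨haeq1, haeq2⟩
    have hc0' : 0 ≤ c' := nonneg_of_width h' haind hw0 hw hTw'
    have hwc' : w = Real.arccos (mcos c') := by rw [← hTw', width_regular h' haind hc0']
    have hcc : c = c' := mcos_inj hc0 hc1 hc0' (h'.lt_one haind) (by rw [← hwc, ← hwc'])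
    obtain ⟨hy, -, hd, -⟩ := ext_unpack h.n2 h.n3 hext
    refine part_two h' haind hc0' h.n2 hy ?_
    rw [hd, gdist, h.i23, hcc]
end
end

section
/- Let 0 < w ≤ π/2 and let U_w ⊂ S² be the Reuleaux triangle U_w = B(x₁,w) ∩ B(x₂,w) ∩ B(x₃,w), where d(xᵢ,xⱼ) = w for all i ≠ j. Then the polar body of U_w satisfies U_w° = −conv( B(x₁, π/2 − w) ∪ B(x₂, π/2 − w) ∪ B(x₃, π/2 − w) ), where −A denotes the antipodal image of A. -/
open scoped RealInnerProductSpace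
open Real MeasureTheory

noncomputable section

open SphericalPal

namespace SphericalPal

lemma norm_of_mem {x : E 2} (h : x ∈ unitSphere 2) : ‖x‖ = 1 := by
  simpa [unitSphere] using h

lemma mem_of_norm {x : E 2} (h : ‖x‖ = 1) : x ∈ unitSphere 2 := by
  simpa [unitSphere] using h

lemma inner_le_one' {x y : E 2} (hx : ‖x‖ = 1) (hy : ‖y‖ = 1) : ⟪x, y⟫ ≤ 1 := by
  have := real_inner_le_norm x y
  rwa [hx, hy, one_mul] at this

lemma neg_one_le_inner' {x y : E 2} (hx : ‖x‖ = 1) (hy : ‖y‖ = 1) : -1 ≤ ⟪x, y⟫ := by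
  have := neg_le_of_abs_le (abs_real_inner_le_norm x y)
  rwa [hx, hy, one_mul] at this

lemma gdist_le_iff {x y : E 2} (hx : ‖x‖ = 1) (hy : ‖y‖ = 1) {r : ℝ} (h0 : 0 ≤ r) (h1 : r ≤ π) :
    gdist x y ≤ r ↔ Real.cos r ≤ ⟪x, y⟫ := by
  have := InnerProductGeometry.inner_eq_cos_angle_of_norm_eq_one hx hy
  rw [gdist_eq_angle hx hy, this]
  exact (Real.strictAntiOn_cos.le_iff_ge ⟨h0, h1⟩
    ⟨InnerProductGeometry.angle_nonneg _ _, InnerProductGeometry.angle_le_pi _ _⟩).symm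

lemma seg_iff {x y z : E 2} (hx : ‖x‖ = 1) (hy : ‖y‖ = 1) (hz : ‖z‖ = 1)
    (hne : gdist x y ≠ π) :
    z ∈ seg x y ↔ ∃ a b : ℝ, 0 ≤ a ∧ 0 ≤ b ∧ z = a • x + b • y := by
  have hz0 : z ≠ 0 := by rintro rfl; simp at hz
  have key := InnerProductGeometry.angle_eq_angle_add_angle_iff (x := x) (y := z) (z := y) hz0
  rw [← gdist_eq_angle hx hy, ← gdist_eq_angle hx hz, ← gdist_eq_angle hz hy] at key
  simp only [hne, false_or, Submodule.mem_span_pair] at key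
  constructor
  · rintro ⟨-, h⟩
    obtain ⟨a, b, h⟩ := key.1 h.symm
    exact ⟨a, b, a.2, b.2, h.symm⟩
  · rintro ⟨a, b, ha, hb, h⟩
    exact ⟨mem_of_norm hz, (key.2 ⟨⟨a, ha⟩, ⟨b, hb⟩, h.symm⟩).symm⟩

lemma gdist_ne_pi {u x y : E 2} (hx : ‖x‖ = 1) (hy : ‖y‖ = 1)
    (hux : 0 < ⟪u, x⟫) (huy : 0 < ⟪u, y⟫) : gdist x y ≠ π := by
  intro h
  rw [gdist_eq_angle hx hy, InnerProductGeometry.angle_eq_pi_iff] at h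
  obtain ⟨-, r, hr, rfl⟩ := h
  rw [real_inner_smul_right] at huy
  nlinarith

/-- The open cone over a spherically convex set is convex. -/
lemma cone_convex {D : Set (E 2)} (hD : SConvex D) :
    Convex ℝ {p : E 2 | ∃ r : ℝ, 0 < r ∧ ∃ d ∈ D, p = r • d} := by
  obtain ⟨hDs, ⟨u, hu, hpos⟩, hseg⟩ := hD
  rintro _ ⟨r, hr, d, hd, rfl⟩ _ ⟨s, hs, e, he, rfl⟩ a b ha hb hab
  set p : E 2 := a • r • d + b • s • e with hp
  have hup : 0 < ⟪u, p⟫ := by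
    rw [hp]
    simp only [inner_add_right, real_inner_smul_right]
    have h1 := mul_pos hr (hpos d hd)
    have h2 := mul_pos hs (hpos e he)
    rcases ha.eq_or_lt with rfl | ha'
    · have : b = 1 := by linarith
      subst this; linarith
    · have := mul_pos ha' h1
      have := mul_nonneg hb h2.le
      linarith
  have hp0 : p ≠ 0 := by
    intro h; rw [h] at hup; simp at hup
  have hn : 0 < ‖p‖ := norm_pos_iff.2 hp0
  refine ⟨‖p‖, hn, ‖p‖⁻¹ • p, ?_, ?_⟩
  · apply hseg d hd e he
    have hd1 := norm_of_mem (hDs hd)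
    have he1 := norm_of_mem (hDs he)
    rw [seg_iff hd1 he1 (by rw [norm_smul, norm_inv, norm_norm, inv_mul_cancel₀ hn.ne'])
      (gdist_ne_pi hd1 he1 (hpos d hd) (hpos e he))]
    refine ⟨‖p‖⁻¹ * (a * r), ‖p‖⁻¹ * (b * s), by positivity, by positivity, ?_⟩
    generalize ‖p‖⁻¹ = q
    rw [hp]
    simp only [smul_add, smul_smul]
  · rw [smul_smul, mul_inv_cancel₀ hn.ne', one_smul]

/-- The solid cap spanned by a geodesic ball. -/
def cap (x : E 2) (w : ℝ) : Set (E 2) :=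
  Metric.closedBall 0 1 ∩ {y | Real.sin w ≤ ⟪x, y⟫}

lemma cap_compact (x : E 2) (w : ℝ) : IsCompact (cap x w) :=
  (isCompact_closedBall (0 : E 2) 1).inter_right
    (isClosed_le continuous_const (by fun_prop))

lemma cap_convex (x : E 2) (w : ℝ) : Convex ℝ (cap x w) := by
  apply (convex_closedBall (0 : E 2) 1).inter
  exact convex_halfSpace_ge (𝕜 := ℝ) (innerSL ℝ x).toLinearMap.isLinear (Real.sin w)

lemma gball_subset_cap {w : ℝ} (hw0 : 0 < w) (hw : w ≤ π / 2) {x : E 2} (hx : ‖x‖ = 1) :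
    gball x (π / 2 - w) ⊆ cap x w := by
  rintro y ⟨hy, hxy⟩
  have hy1 := norm_of_mem hy
  rw [gdist_le_iff hx hy1 (by linarith) (by linarith [Real.pi_pos]),
    Real.cos_pi_div_two_sub] at hxy
  exact ⟨by simp [hy1], hxy⟩

lemma center_mem_cap {w : ℝ} {x : E 2} (hx : ‖x‖ = 1) : x ∈ cap x w := by
  refine ⟨by simp [hx], ?_⟩
  simp only [Set.mem_setOf_eq]
  rw [real_inner_self_eq_norm_sq, hx]
  norm_num [Real.sin_le_one]

lemma cap_subset_cone {w : ℝ} (hw0 : 0 < w) (hw : w ≤ π / 2) {x : E 2} (hx : ‖x‖ = 1)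
    {D : Set (E 2)} (hD : gball x (π / 2 - w) ⊆ D) :
    cap x w ⊆ {p : E 2 | ∃ r : ℝ, 0 < r ∧ ∃ d ∈ D, p = r • d} := by
  rintro p ⟨hp1, hp⟩
  have hpi := Real.pi_pos
  simp only [Metric.mem_closedBall, dist_zero_right] at hp1
  simp only [Set.mem_setOf_eq] at hp
  have hsin : 0 < Real.sin w := Real.sin_pos_of_pos_of_lt_pi hw0 (by linarith)
  have hp0 : p ≠ 0 := by
    rintro rfl
    simp at hp; linarith
  have hn : 0 < ‖p‖ := norm_pos_iff.2 hp0
  have hn1 : ‖‖p‖⁻¹ • p‖ = 1 := by rw [norm_smul, norm_inv, norm_norm, inv_mul_cancel₀ hn.ne']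
  refine ⟨‖p‖, hn, ‖p‖⁻¹ • p, hD ⟨mem_of_norm hn1, ?_⟩, ?_⟩
  · rw [gdist_le_iff hx hn1 (by linarith) (by linarith), Real.cos_pi_div_two_sub,
      real_inner_smul_right]
    have := (one_le_inv₀ hn).2 hp1
    nlinarith
  · rw [smul_smul, mul_inv_cancel₀ hn.ne', one_smul]

lemma convexJoin_compact {s t : Set (E 2)} (hs : IsCompact s) (ht : IsCompact t) :
    IsCompact (convexJoin ℝ s t) := by
  have : convexJoin ℝ s t =
      (fun q : ℝ × E 2 × E 2 => (1 - q.1) • q.2.1 + q.1 • q.2.2) '' (Set.Icc 0 1 ×ˢ s ×ˢ t) := by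
    ext z
    simp only [mem_convexJoin, segment_eq_image, Set.mem_image, Set.mem_prod, Prod.exists]
    constructor
    · rintro ⟨a, ha, b, hb, θ, hθ, h⟩
      exact ⟨θ, a, b, ⟨hθ, ha, hb⟩, h⟩
    · rintro ⟨θ, a, b, ⟨hθ, ha, hb⟩, h⟩
      exact ⟨a, ha, b, hb, θ, hθ, h⟩
  rw [this]
  exact (isCompact_Icc.prod (hs.prod ht)).image (by fun_prop)

/-- Polarity for balls. -/
lemma ball_dual {w : ℝ} (hw0 : 0 < w) (hw : w ≤ π / 2) {x a : E 2} (hx : ‖x‖ = 1) (ha : ‖a‖ = 1)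
    (h : ∀ y ∈ gball x (π / 2 - w), 0 ≤ ⟪a, y⟫) : gdist x a ≤ w := by
  have hpi := Real.pi_pos
  rw [gdist_le_iff hx ha hw0.le (by linarith)]
  have hmem : ∀ y : E 2, ‖y‖ = 1 → Real.sin w ≤ ⟪x, y⟫ → 0 ≤ ⟪a, y⟫ := by
    intro y hy hxy
    refine h y ⟨mem_of_norm hy, ?_⟩
    rw [gdist_le_iff hx hy (by linarith) (by linarith), Real.cos_pi_div_two_sub]
    exact hxy
  have hxx : ⟪x, x⟫ = (1:ℝ) := by rw [real_inner_self_eq_norm_sq, hx]; norm_num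
  have haa : ⟪a, a⟫ = (1:ℝ) := by rw [real_inner_self_eq_norm_sq, ha]; norm_num
  have hc0 : 0 ≤ ⟪x, a⟫ := by
    rw [real_inner_comm]
    exact hmem x hx (by rw [hxx]; exact Real.sin_le_one w)
  set c : ℝ := ⟪x, a⟫ with hc
  have hac : ⟪a, x⟫ = c := by rw [real_inner_comm]
  by_contra hlt
  push Not at hlt
  have hsin : 0 < Real.sin w := Real.sin_pos_of_pos_of_lt_pi hw0 (by linarith)
  have hsc := Real.sin_sq_add_cos_sq w
  set r : E 2 := a - c • x with hr
  have hxr : ⟪x, r⟫ = (0:ℝ) := by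
    rw [hr, inner_sub_right, real_inner_smul_right, hxx, ← hc]; ring
  have har : ⟪a, r⟫ = 1 - c ^ 2 := by
    rw [hr, inner_sub_right, real_inner_smul_right, haa, hac]; ring
  have hrr : ‖r‖ ^ 2 = 1 - c ^ 2 := by
    rw [← real_inner_self_eq_norm_sq]
    nth_rewrite 1 [hr]
    rw [inner_sub_left, real_inner_smul_left, hxr, har]; ring
  have hrs : Real.sin w < ‖r‖ := by
    apply lt_of_pow_lt_pow_left₀ 2 (norm_nonneg _)
    nlinarith
  have hr0 : 0 < ‖r‖ := hsin.trans hrs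
  have hinv : ‖r‖⁻¹ * ‖r‖ = 1 := inv_mul_cancel₀ hr0.ne'
  have hy := hmem (Real.sin w • x - (Real.cos w * ‖r‖⁻¹) • r) ?_ ?_
  · rw [inner_sub_right, real_inner_smul_right, real_inner_smul_right, hac, har, ← hrr] at hy
    have : Real.cos w * ‖r‖⁻¹ * ‖r‖ ^ 2 = Real.cos w * ‖r‖ := by
      linear_combination Real.cos w * ‖r‖ * hinv
    rw [this] at hy
    nlinarith
  · have : ‖Real.sin w • x - (Real.cos w * ‖r‖⁻¹) • r‖ ^ 2 = 1 := by
      rw [norm_sub_sq_real, real_inner_smul_left, real_inner_smul_right, hxr, norm_smul, norm_smul,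
        hx, mul_pow, mul_pow, Real.norm_eq_abs, Real.norm_eq_abs, sq_abs, sq_abs]
      linear_combination hsc + Real.cos w ^ 2 * (‖r‖⁻¹ * ‖r‖ + 1) * hinv
    nlinarith [norm_nonneg (Real.sin w • x - (Real.cos w * ‖r‖⁻¹) • r)]
  · rw [inner_sub_right, real_inner_smul_right, real_inner_smul_right, hxr, hxx]; linarith

/-- Elementary direction of polarity for balls. -/
lemma ball_dual' {w : ℝ} {x a y : E 2} (hx : ‖x‖ = 1) (ha : ‖a‖ = 1)
    (hxa : gdist x a ≤ w) (hy : y ∈ gball x (π / 2 - w)) : 0 ≤ ⟪a, y⟫ := by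
  have hy1 := norm_of_mem hy.1
  have h2 := hy.2
  rw [gdist_eq_angle hx hy1] at h2
  rw [gdist_eq_angle hx ha, InnerProductGeometry.angle_comm] at hxa
  have := InnerProductGeometry.angle_le_angle_add_angle a x y
  rw [InnerProductGeometry.inner_eq_cos_angle_of_norm_eq_one ha hy1]
  have h0 := InnerProductGeometry.angle_nonneg a y
  exact Real.cos_nonneg_of_neg_pi_div_two_le_of_le (by linarith [Real.pi_pos]) (by linarith)

/-- The bipolar argument. -/
lemma bipolar {B H D : Set (E 2)} {v : E 2} (hH : IsCompact H) (hHc : Convex ℝ H)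
    (hBH : B ⊆ H) (hB1 : B ⊆ unitSphere 2) (hD : SConvex D)
    (hsub : H ⊆ {p : E 2 | ∃ r : ℝ, 0 < r ∧ ∃ d ∈ D, p = r • d}) (hv : ‖v‖ = 1)
    (h : ∀ a : E 2, ‖a‖ = 1 → (∀ y ∈ B, 0 ≤ ⟪a, y⟫) → 0 ≤ ⟪a, v⟫) : v ∈ D := by
  set R : Set (E 2) := (fun t : ℝ => t • v) '' Set.Ici 0 with hR
  have hv0 : v ≠ 0 := by rintro rfl; simp at hv
  have hRc : IsClosed R := by
    exact (isClosedEmbedding_smul_left hv0).isClosedMap _ isClosed_Ici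
  have hRconv : Convex ℝ R := by
    rintro _ ⟨s, hs, rfl⟩ _ ⟨t, ht, rfl⟩ a b ha hb hab
    refine ⟨a * s + b * t, ?_, ?_⟩
    · simp only [Set.mem_Ici] at *; positivity
    · simp [add_smul, mul_smul]
  by_cases hdisj : Disjoint H R
  · exfalso
    obtain ⟨f, s, t, hf1, hst, hf2⟩ := geometric_hahn_banach_compact_closed
      hHc hH hRconv hRc hdisj
    obtain ⟨g, rfl⟩ : ∃ g : E 2, f = innerSL ℝ g :=
      ⟨(InnerProductSpace.toDual ℝ (E 2)).symm f, by ext y; simp⟩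
    simp only [innerSL_apply_apply] at hf1 hf2
    have ht0 : t < 0 := by simpa using hf2 0 ⟨0, by simp, by simp⟩
    have hgv : 0 ≤ ⟪g, v⟫ := by
      by_contra hneg
      push Not at hneg
      have := hf2 ((t / ⟪g, v⟫) • v) ⟨_, (div_pos_of_neg_of_neg ht0 hneg).le, rfl⟩
      rw [real_inner_smul_right, div_mul_cancel₀ _ hneg.ne] at this
      exact lt_irrefl _ this
    set a : E 2 := s • v - g with ha
    have hvv : ⟪v, v⟫ = (1:ℝ) := by rw [real_inner_self_eq_norm_sq, hv]; norm_num
    have hav : ⟪a, v⟫ < 0 := by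
      rw [ha, inner_sub_left, real_inner_smul_left, hvv]; linarith
    have ha0 : a ≠ 0 := by
      intro h0; rw [h0] at hav; simp at hav
    have hn : 0 < ‖a‖ := norm_pos_iff.2 ha0
    have := h (‖a‖⁻¹ • a) (by rw [norm_smul, norm_inv, norm_norm, inv_mul_cancel₀ hn.ne']) ?_
    · rw [real_inner_smul_left] at this
      have := mul_neg_of_pos_of_neg (inv_pos.2 hn) hav
      linarith
    · intro y hy
      rw [real_inner_smul_left]
      apply mul_nonneg (inv_pos.2 hn).le
      have h1 := hf1 y (hBH hy)
      have h2 := inner_le_one' hv (norm_of_mem (hB1 hy))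
      rw [ha, inner_sub_left, real_inner_smul_left]
      nlinarith
  · obtain ⟨p, hp, t, ht, rfl⟩ := Set.not_disjoint_iff.1 hdisj
    obtain ⟨r, hr, d, hd, he⟩ := hsub hp
    simp only [Set.mem_Ici] at ht
    have hd1 := norm_of_mem (hD.1 hd)
    have hn := congrArg norm he
    simp only [norm_smul, hv, hd1, mul_one, Real.norm_eq_abs, abs_of_nonneg ht,
      abs_of_pos hr] at hn
    subst hn
    have : v = d := smul_right_injective _ hr.ne' he
    rwa [this]

end SphericalPal

/-- the polar of a spherical Reuleaux triangle is the antipodal image of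
the convex hull of three balls of radius `π/2 - w` centered at the same points. -/
theorem polar_of_reuleaux (w : ℝ) (hw0 : 0 < w) (hw : w ≤ π / 2)
    (x₁ x₂ x₃ : E 2) (hx : IsRegularCenters x₁ x₂ x₃ w) :
    polar (gball x₁ w ∩ gball x₂ w ∩ gball x₃ w) =
      -(sconv (gball x₁ (π / 2 - w) ∪ gball x₂ (π / 2 - w) ∪ gball x₃ (π / 2 - w))) := by
  obtain ⟨h1, h2, h3, h12, h23, h13⟩ := hx
  have hpi := Real.pi_pos
  have n1 := norm_of_mem h1
  have n2 := norm_of_mem h2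
  have n3 := norm_of_mem h3
  have hself : ∀ x : E 2, ‖x‖ = 1 → gdist x x = 0 := by
    intro x hx
    simp [gdist, real_inner_self_eq_norm_sq, hx]
  have hcomm : ∀ x y : E 2, gdist x y = gdist y x := by
    intro x y; simp [gdist, real_inner_comm]
  ext v
  rw [Set.mem_neg]
  constructor
  · rintro ⟨hv, hle⟩ D ⟨hD, hBD⟩
    have s1 := gball_subset_cap hw0 hw n1
    have s2 := gball_subset_cap hw0 hw n2
    have s3 := gball_subset_cap hw0 hw n3
    have ne1 : (cap x₁ w).Nonempty := ⟨x₁, center_mem_cap n1⟩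
    have ne2 : (cap x₂ w).Nonempty := ⟨x₂, center_mem_cap n2⟩
    have ne3 : (cap x₃ w).Nonempty := ⟨x₃, center_mem_cap n3⟩
    have j1 : cap x₁ w ⊆ convexJoin ℝ (cap x₁ w) (cap x₂ w) := subset_convexJoin_left ne2
    have j2 : cap x₂ w ⊆ convexJoin ℝ (cap x₁ w) (cap x₂ w) := subset_convexJoin_right ne1
    have j12 : convexJoin ℝ (cap x₁ w) (cap x₂ w) ⊆
        convexJoin ℝ (convexJoin ℝ (cap x₁ w) (cap x₂ w)) (cap x₃ w) := subset_convexJoin_left ne3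
    have j3 : cap x₃ w ⊆ convexJoin ℝ (convexJoin ℝ (cap x₁ w) (cap x₂ w)) (cap x₃ w) :=
      subset_convexJoin_right (ne1.mono j1)
    have hcone := cone_convex hD
    refine bipolar (B := gball x₁ (π / 2 - w) ∪ gball x₂ (π / 2 - w) ∪ gball x₃ (π / 2 - w))
      (convexJoin_compact (convexJoin_compact (cap_compact x₁ w) (cap_compact x₂ w))
        (cap_compact x₃ w))
      (((cap_convex _ _).convexJoin (cap_convex _ _)).convexJoin (cap_convex _ _))
      ?_ ?_ hD ?_ (by rw [norm_neg]; exact norm_of_mem hv) ?_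
    · rintro y ((hy | hy) | hy)
      · exact j12 (j1 (s1 hy))
      · exact j12 (j2 (s2 hy))
      · exact j3 (s3 hy)
    · rintro y ((hy | hy) | hy) <;> exact hy.1
    · refine convexJoin_subset (convexJoin_subset ?_ ?_ hcone) ?_ hcone
      · exact cap_subset_cone hw0 hw n1 fun y hy => hBD (Or.inl (Or.inl hy))
      · exact cap_subset_cone hw0 hw n2 fun y hy => hBD (Or.inl (Or.inr hy))
      · exact cap_subset_cone hw0 hw n3 fun y hy => hBD (Or.inr hy)
    · intro a ha hay
      rw [inner_neg_right]
      have ha' := mem_of_norm ha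
      have := hle a ⟨⟨⟨ha', ball_dual hw0 hw n1 ha fun y hy => hay y (Or.inl (Or.inl hy))⟩,
        ⟨ha', ball_dual hw0 hw n2 ha fun y hy => hay y (Or.inl (Or.inr hy))⟩⟩,
        ⟨ha', ball_dual hw0 hw n3 ha fun y hy => hay y (Or.inr hy)⟩⟩
      linarith
  · intro hv
    set U := gball x₁ w ∩ gball x₂ w ∩ gball x₃ w with hU
    have hu1 : x₁ ∈ U := ⟨⟨⟨h1, by rw [hself _ n1]; exact hw0.le⟩,
      ⟨h1, by rw [hcomm, h12]⟩⟩, ⟨h1, by rw [hcomm, h13]⟩⟩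
    have hu2 : x₂ ∈ U := ⟨⟨⟨h2, h12.le⟩, ⟨h2, by rw [hself _ n2]; exact hw0.le⟩⟩,
      ⟨h2, by rw [hcomm, h23]⟩⟩
    have hu3 : x₃ ∈ U := ⟨⟨⟨h3, h13.le⟩, ⟨h3, h23.le⟩⟩, ⟨h3, by rw [hself _ n3]; exact hw0.le⟩⟩
    set K : Set (E 2) := {v | v ∈ unitSphere 2 ∧ ∀ a ∈ U, 0 ≤ ⟪a, v⟫} with hK
    have hinn : ∀ x y : E 2, ‖x‖ = 1 → ‖y‖ = 1 → gdist x y = w → ⟪x, y⟫ = Real.cos w := by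
      intro x y hx hy h
      rw [InnerProductGeometry.inner_eq_cos_angle_of_norm_eq_one hx hy, ← gdist_eq_angle hx hy, h]
    have i12 := hinn _ _ n1 n2 h12
    have i13 := hinn _ _ n1 n3 h13
    have i23 := hinn _ _ n2 n3 h23
    have i21 : ⟪x₂, x₁⟫ = Real.cos w := by rw [real_inner_comm]; exact i12
    have i31 : ⟪x₃, x₁⟫ = Real.cos w := by rw [real_inner_comm]; exact i13
    have i32 : ⟪x₃, x₂⟫ = Real.cos w := by rw [real_inner_comm]; exact i23
    have i11 : ⟪x₁, x₁⟫ = (1:ℝ) := by rw [real_inner_self_eq_norm_sq, n1]; norm_num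
    have i22 : ⟪x₂, x₂⟫ = (1:ℝ) := by rw [real_inner_self_eq_norm_sq, n2]; norm_num
    have i33 : ⟪x₃, x₃⟫ = (1:ℝ) := by rw [real_inner_self_eq_norm_sq, n3]; norm_num
    have hc0 : 0 ≤ Real.cos w := Real.cos_nonneg_of_neg_pi_div_two_le_of_le (by linarith) hw
    have hc1 : Real.cos w < 1 := by
      have := Real.cos_lt_cos_of_nonneg_of_le_pi le_rfl (by linarith : w ≤ π) hw0
      rwa [Real.cos_zero] at this
    have hli : LinearIndependent ℝ ![x₁, x₂, x₃] := by
      rw [Fintype.linearIndependent_iff]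
      intro g hg
      simp only [Fin.sum_univ_three, Matrix.cons_val_zero, Matrix.cons_val_one,
        Matrix.cons_val_two, Matrix.cons_val, Matrix.tail_cons, Matrix.head_cons] at hg
      have e1 := congrArg (fun z => ⟪x₁, z⟫) hg
      have e2 := congrArg (fun z => ⟪x₂, z⟫) hg
      have e3 := congrArg (fun z => ⟪x₃, z⟫) hg
      simp only [inner_add_right, real_inner_smul_right, inner_zero_right, i11, i12, i13, i21,
        i22, i23, i31, i32, i33] at e1 e2 e3
      have hs : g 0 + g 1 + g 2 = 0 := by
        have : (g 0 + g 1 + g 2) * (1 + 2 * Real.cos w) = 0 := by linear_combination e1 + e2 + e3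
        rcases mul_eq_zero.1 this with h | h
        · exact h
        · linarith
      have hne : (1 - Real.cos w) ≠ 0 := by linarith
      intro i
      apply (mul_eq_zero.1 (?_ : (1 - Real.cos w) * g i = 0)).resolve_left hne
      fin_cases i
      · show (1 - Real.cos w) * g 0 = 0
        linear_combination e1 - Real.cos w * hs
      · show (1 - Real.cos w) * g 1 = 0
        linear_combination e2 - Real.cos w * hs
      · show (1 - Real.cos w) * g 2 = 0
        linear_combination e3 - Real.cos w * hs
    have hspan := hli.span_eq_top_of_card_eq_finrank (by simp)
    have hzero : ∀ z : E 2, ⟪x₁, z⟫ = (0:ℝ) → ⟪x₂, z⟫ = (0:ℝ) → ⟪x₃, z⟫ = (0:ℝ) → z = 0 := by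
      intro z z1 z2 z3
      have hz : z ∈ Submodule.span ℝ (Set.range ![x₁, x₂, x₃]) := by rw [hspan]; trivial
      have : ∀ y ∈ Submodule.span ℝ (Set.range ![x₁, x₂, x₃]), ⟪y, z⟫ = (0:ℝ) := by
        intro y hy
        induction hy using Submodule.span_induction with
        | mem y hy =>
          obtain ⟨i, rfl⟩ := hy
          fin_cases i
          · exact z1
          · exact z2
          · exact z3
        | zero => simp
        | add a b _ _ ha hb => rw [inner_add_left, ha, hb, add_zero]
        | smul c a _ ha => rw [real_inner_smul_left, ha, mul_zero]
      exact inner_self_eq_zero.1 (this z hz)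
    set s : E 2 := x₁ + x₂ + x₃ with hs
    have hsK : ∀ y ∈ K, 0 < ⟪s, y⟫ := by
      rintro y ⟨hy, hay⟩
      have a1 := hay _ hu1
      have a2 := hay _ hu2
      have a3 := hay _ hu3
      rw [hs, inner_add_left, inner_add_left]
      by_contra hneg
      push Not at hneg
      have := hzero y (by linarith) (by linarith) (by linarith)
      have hy1 := norm_of_mem hy
      rw [this] at hy1; simp at hy1
    have hs0 : s ≠ 0 := by
      intro h0
      have : ⟪s, x₁⟫ = (0:ℝ) := by rw [h0]; simp
      rw [hs, inner_add_left, inner_add_left, i11, i21, i31] at this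
      linarith
    have hsn : 0 < ‖s‖ := norm_pos_iff.2 hs0
    have hKconv : SConvex K := by
      refine ⟨fun y hy => hy.1, ⟨‖s‖⁻¹ • s, mem_of_norm ?_, ?_⟩, ?_⟩
      · rw [norm_smul, norm_inv, norm_norm, inv_mul_cancel₀ hsn.ne']
      · intro y hy
        rw [real_inner_smul_left]
        exact mul_pos (inv_pos.2 hsn) (hsK y hy)
      · intro x hx y hy z hz
        have hx1 := norm_of_mem hx.1
        have hy1 := norm_of_mem hy.1
        obtain ⟨a, b, ha, hb, he⟩ := (seg_iff hx1 hy1 (norm_of_mem hz.1)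
          (gdist_ne_pi hx1 hy1 (hsK x hx) (hsK y hy))).1 hz
        refine ⟨hz.1, fun c hc => ?_⟩
        rw [he, inner_add_right, real_inner_smul_right, real_inner_smul_right]
        exact add_nonneg (mul_nonneg ha (hx.2 c hc)) (mul_nonneg hb (hy.2 c hc))
    have hvK : -v ∈ K := by
      refine hv K ⟨hKconv, ?_⟩
      rintro y ((hy | hy) | hy) <;> refine ⟨hy.1, fun a ha => ?_⟩
      · exact ball_dual' n1 (norm_of_mem ha.1.1.1) ha.1.1.2 hy
      · exact ball_dual' n2 (norm_of_mem ha.1.1.1) ha.1.2.2 hy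
      · exact ball_dual' n3 (norm_of_mem ha.1.1.1) ha.2.2 hy
    refine ⟨mem_of_norm (by rw [← norm_neg]; exact norm_of_mem hvK.1), fun a ha => ?_⟩
    have := hvK.2 a ha
    rw [inner_neg_right] at this
    linarith
end
end

section
/- Let K, L ⊂ S² be convex bodies such that δ(K,L) < π/2. Then δ(K,L) = δ(K°, L°), where K° and L° denote the polar bodies of K and L. -/
open scoped RealInnerProductSpace
open Real MeasureTheory

noncomputable section

open SphericalPal

lemma SphericalPal.gdist_eq_angle_s18 {n : ℕ} {x y : E n} (hx : ‖x‖ = 1) (hy : ‖y‖ = 1) :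
    gdist x y = InnerProductGeometry.angle x y := by
  simp [gdist, InnerProductGeometry.angle, hx, hy]

lemma SphericalPal.norm_of_mem_s18 {n : ℕ} {x : E n} (hx : x ∈ unitSphere n) : ‖x‖ = 1 := by
  simpa [unitSphere] using hx

lemma SphericalPal.mem_of_norm_s18 {n : ℕ} {x : E n} (hx : ‖x‖ = 1) : x ∈ unitSphere n := by
  simpa [unitSphere] using hx

lemma SphericalPal.gdist_tri {n : ℕ} {x y z : E n} (hx : ‖x‖ = 1) (hy : ‖y‖ = 1) (hz : ‖z‖ = 1) :
    gdist x z ≤ gdist x y + gdist y z := by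
  rw [gdist_eq_angle_s18 hx hy, gdist_eq_angle_s18 hy hz, gdist_eq_angle_s18 hx hz]
  exact InnerProductGeometry.angle_le_angle_add_angle x y z

lemma SphericalPal.pi_half_le_gdist {n : ℕ} {x y : E n} (h : ⟪x, y⟫ ≤ 0) : π / 2 ≤ gdist x y := by
  have h1 := Real.arccos_le_arccos h
  rwa [Real.arccos_zero] at h1

lemma SphericalPal.sdist_le {n : ℕ} {x y : E n} {A : Set (E n)} (hy : y ∈ A) :
    sdist x A ≤ gdist x y :=
  csInf_le ⟨0, by rintro _ ⟨z, _, rfl⟩; exact Real.arccos_nonneg _⟩ ⟨y, hy, rfl⟩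

lemma SphericalPal.le_sdist {n : ℕ} {x : E n} {A : Set (E n)} (hA : A.Nonempty) {c : ℝ}
    (h : ∀ y ∈ A, c ≤ gdist x y) : c ≤ sdist x A :=
  le_csInf (hA.image _) (by rintro _ ⟨z, hz, rfl⟩; exact h z hz)

lemma SphericalPal.sdist_nonneg {n : ℕ} (x : E n) (A : Set (E n)) : 0 ≤ sdist x A :=
  Real.sInf_nonneg (by rintro _ ⟨z, _, rfl⟩; exact Real.arccos_nonneg _)

lemma SphericalPal.sdist_self {n : ℕ} {x : E n} {A : Set (E n)} (h1 : ‖x‖ = 1) (hx : x ∈ A) :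
    sdist x A ≤ 0 := by
  refine (sdist_le hx).trans ?_
  simp [gdist, h1]

lemma SphericalPal.le_sup {n : ℕ} {x : E n} {A B : Set (E n)} (hB : B.Nonempty) (hx : x ∈ A) :
    sdist x B ≤ sSup ((fun x => sdist x B) '' A) := by
  obtain ⟨b, hb⟩ := hB
  refine le_csSup ⟨π, ?_⟩ ⟨x, hx, rfl⟩
  rintro _ ⟨z, _, rfl⟩
  exact (sdist_le hb).trans (Real.arccos_le_pi _)

lemma SphericalPal.sup_nonneg {n : ℕ} (A B : Set (E n)) :
    0 ≤ sSup ((fun x => sdist x B) '' A) :=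
  Real.sSup_nonneg (by rintro _ ⟨z, _, rfl⟩; exact sdist_nonneg _ _)

/-- The normalised positive combination of two points of a convex set is in the set. -/
lemma SphericalPal.comb_mem {n : ℕ} {K : Set (E n)} (hK : SConvex K) {p y : E n} (hp : p ∈ K)
    (hy : y ∈ K) {t : ℝ} (ht : 0 < t) :
    0 < ‖p + t • y‖ ∧ ‖p + t • y‖⁻¹ • (p + t • y) ∈ K := by
  obtain ⟨hs, ⟨u, hu, hpos⟩, hseg⟩ := hK
  have hp1 := norm_of_mem_s18 (hs hp)
  have hy1 := norm_of_mem_s18 (hs hy)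
  have hne : p + t • y ≠ 0 := by
    intro h0
    have h1 : ⟪u, p + t • y⟫ = 0 := by rw [h0, inner_zero_right]
    rw [inner_add_right, real_inner_smul_right] at h1
    have := hpos p hp
    have := mul_pos ht (hpos y hy)
    linarith
  have hn : 0 < ‖p + t • y‖ := norm_pos_iff.2 hne
  refine ⟨hn, hseg p hp y hy ?_⟩
  have hz : ‖‖p + t • y‖⁻¹ • (p + t • y)‖ = 1 := by
    rw [norm_smul, norm_inv, norm_norm, inv_mul_cancel₀ hn.ne']
  refine ⟨mem_of_norm_s18 hz, ?_⟩
  rw [gdist_eq_angle_s18 hp1 hz, gdist_eq_angle_s18 hz hy1, gdist_eq_angle_s18 hp1 hy1,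
    InnerProductGeometry.angle_smul_right_of_pos _ _ (inv_pos.2 hn),
    InnerProductGeometry.angle_smul_left_of_pos _ _ (inv_pos.2 hn)]
  have hy0 : t • y ≠ 0 := smul_ne_zero ht.ne' (by rintro rfl; simp at hy1)
  have := InnerProductGeometry.angle_eq_angle_add_add_angle_add p hy0
  rw [InnerProductGeometry.angle_smul_right_of_pos _ _ ht,
    InnerProductGeometry.angle_smul_left_of_pos _ _ ht] at this
  rw [this, InnerProductGeometry.angle_comm (p + t • y) y]

/-- Spherical Moreau decomposition. -/
lemma SphericalPal.moreau {n : ℕ} {K : Set (E n)} (hK : IsConvexBody K) {x : E n}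
    (hx : ‖x‖ = 1) :
    x ∈ K ∨ x ∈ polar K ∨ ∃ p ∈ K, ∃ q ∈ polar K, gdist x p + gdist x q = π / 2 := by
  obtain ⟨hc, hcomp, hint⟩ := hK
  have hne : K.Nonempty := by
    obtain ⟨a, ha⟩ := hint
    exact ⟨a, ha.1⟩
  obtain ⟨p, hp, hmax⟩ := hcomp.exists_isMaxOn hne
    (f := fun y => ⟪x, y⟫) (by fun_prop)
  replace hmax : ∀ y ∈ K, ⟪x, y⟫ ≤ ⟪x, p⟫ := fun y hy => hmax hy
  have hp1 := norm_of_mem_s18 (hc.1 hp)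
  have hpp : ⟪p, p⟫ = 1 := by rw [real_inner_self_eq_norm_sq, hp1]; norm_num
  obtain ⟨m, hm⟩ : ∃ m, m = ⟪x, p⟫ := ⟨_, rfl⟩
  rw [← hm] at hmax
  rcases le_or_gt m 0 with hm0 | hm0
  · right; left
    refine ⟨mem_of_norm_s18 hx, fun a ha => ?_⟩
    rw [real_inner_comm]
    exact (hmax a ha).trans hm0
  by_cases hq : x - m • p = 0
  · left
    have hxp : x = m • p := sub_eq_zero.1 hq
    have : m = 1 := by
      have h1 := hx
      rw [hxp, norm_smul, hp1, mul_one, Real.norm_of_nonneg hm0.le] at h1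
      exact h1
    rw [hxp, this, one_smul]
    exact hp
  right; right
  have hs : 0 < ‖x - m • p‖ := norm_pos_iff.2 hq
  set s := ‖x - m • p‖ with hsdef
  have hq1 : ‖s⁻¹ • (x - m • p)‖ = 1 := by
    rw [norm_smul, norm_inv, hsdef, norm_norm, inv_mul_cancel₀ hs.ne']
  refine ⟨p, hp, s⁻¹ • (x - m • p), ⟨mem_of_norm_s18 hq1, fun y hy => ?_⟩, ?_⟩
  · rw [real_inner_smul_right]
    refine mul_nonpos_of_nonneg_of_nonpos (inv_nonneg.2 hs.le) ?_
    have hy1 := norm_of_mem_s18 (hc.1 hy)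
    rw [real_inner_comm, inner_sub_left, real_inner_smul_left]
    refine le_of_forall_pos_le_add fun ε hε => ?_
    obtain ⟨t, ht, hte⟩ : ∃ t : ℝ, 0 < t ∧ m * t = 2 * ε :=
      ⟨2 * ε / m, by positivity, by field_simp⟩
    obtain ⟨hn, hmem⟩ := comb_mem hc hp hy ht
    have h1 := hmax _ hmem
    rw [real_inner_smul_right, inner_add_right, real_inner_smul_right, ← hm,
      inv_mul_le_iff₀ hn] at h1
    have h2 : ‖p + t • y‖ ^ 2 = 1 + 2 * (t * ⟪p, y⟫) + t ^ 2 := by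
      rw [norm_add_sq_real, real_inner_smul_right, hp1, norm_smul, hy1, Real.norm_of_nonneg ht.le]
      ring
    have h3 : ‖p + t • y‖ ≤ 1 + t * ⟪p, y⟫ + t ^ 2 / 2 := by
      nlinarith [sq_nonneg (‖p + t • y‖ - 1)]
    have h4 := mul_le_mul_of_nonneg_left h3 hm0.le
    have h5 : t * (⟪x, y⟫ - m * ⟪p, y⟫) ≤ t * (0 + ε) := by
      have : m * t ^ 2 = 2 * ε * t := by rw [← hte]; ring
      nlinarith
    exact le_of_mul_le_mul_left h5 ht
  · rw [gdist_eq_angle_s18 hx hp1, gdist_eq_angle_s18 hx hq1]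
    have ho : ⟪p, x - m • p⟫ = 0 := by
      rw [inner_sub_right, real_inner_smul_right, hpp, real_inner_comm, ← hm]; ring
    have := InnerProductGeometry.angle_eq_angle_add_add_angle_add (m • p) hq
    rw [add_sub_cancel, InnerProductGeometry.angle_smul_left_of_pos _ _ hm0,
      InnerProductGeometry.angle_smul_left_of_pos _ _ hm0,
      InnerProductGeometry.inner_eq_zero_iff_angle_eq_pi_div_two _ _ |>.1 ho] at this
    rw [InnerProductGeometry.angle_smul_right_of_pos _ _ (inv_pos.2 hs),
      InnerProductGeometry.angle_comm x p, InnerProductGeometry.angle_comm x (x - m • p), this]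

lemma SphericalPal.body_nonempty {n : ℕ} {K : Set (E n)} (hK : IsConvexBody K) : K.Nonempty := by
  obtain ⟨a, ha⟩ := hK.2.2
  exact ⟨a, ha.1⟩

lemma SphericalPal.polar_nonempty {n : ℕ} {K : Set (E n)} (hK : IsConvexBody K) :
    (polar K).Nonempty := by
  obtain ⟨u, hu, h⟩ := hK.1.2.1
  refine ⟨-u, mem_of_norm_s18 (by rw [norm_neg, norm_of_mem_s18 hu]), fun a ha => ?_⟩
  rw [inner_neg_right, real_inner_comm]
  linarith [h a ha]

lemma SphericalPal.half {n : ℕ} {K L : Set (E n)} (hK : IsConvexBody K) (hL : IsConvexBody L)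
    (h : sSup ((fun x => sdist x L) '' K) < π / 2) :
    sSup ((fun x => sdist x L) '' K) = sSup ((fun x => sdist x (polar K)) '' (polar L)) := by
  have key : ∀ x ∈ K, x ∈ polar L → False := by
    intro x hx hxL
    have h1 : π / 2 ≤ sdist x L := le_sdist (body_nonempty hL) fun y hy =>
      pi_half_le_gdist (by rw [real_inner_comm]; exact hxL.2 y hy)
    linarith [le_sup (body_nonempty hL) hx]
  apply le_antisymm
  · refine Real.sSup_le ?_ (sup_nonneg _ _)
    rintro _ ⟨x, hx, rfl⟩
    have hx1 := norm_of_mem_s18 (hK.1.1 hx)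
    rcases moreau hL hx1 with hxL | hxL | ⟨p, hp, q, hq, hpq⟩
    · exact (sdist_self hx1 hxL).trans (sup_nonneg _ _)
    · exact (key x hx hxL).elim
    · refine (sdist_le hp).trans (le_trans ?_ (le_sup (polar_nonempty hK) hq))
      refine le_sdist (polar_nonempty hK) fun v hv => ?_
      have h1 := pi_half_le_gdist (hv.2 x hx)
      have h2 := gdist_tri hx1 (norm_of_mem_s18 hq.1) (norm_of_mem_s18 hv.1)
      linarith
  · refine Real.sSup_le ?_ (sup_nonneg _ _)
    rintro _ ⟨u, hu, rfl⟩
    have hu1 := norm_of_mem_s18 hu.1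
    rcases moreau hK hu1 with huK | huK | ⟨p, hp, q, hq, hpq⟩
    · exact (key u huK hu).elim
    · exact (sdist_self hu1 huK).trans (sup_nonneg _ _)
    · refine (sdist_le hq).trans (le_trans ?_ (le_sup (body_nonempty hL) hp))
      refine le_sdist (body_nonempty hL) fun y hy => ?_
      have h1 : π / 2 ≤ gdist u y :=
        pi_half_le_gdist (by rw [real_inner_comm]; exact hu.2 y hy)
      have h2 := gdist_tri hu1 (norm_of_mem_s18 (hK.1.1 hp)) (norm_of_mem_s18 (hL.1.1 hy))
      linarith

/-- Glasauer: polarity preserves the Hausdorff distance of spherical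
convex bodies, provided this distance is less than `π/2`. -/
theorem hausdorff_polarity (K L : Set (E 2)) (hK : IsConvexBody K) (hL : IsConvexBody L)
    (h : hausdorffG K L < π / 2) :
    hausdorffG K L = hausdorffG (polar K) (polar L) := by
  have h1 := half hK hL (lt_of_le_of_lt (le_max_left _ _) h)
  have h2 := half hL hK (lt_of_le_of_lt (le_max_right _ _) h)
  unfold hausdorffG
  rw [h1, h2, max_comm]
end
end
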